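/- arXiv:1703.08725 — 2 statements merged into one kernel-verified Lean document; each statement's English description precedes it below -/
import Mathlib

section
/- Suppose that Γ := (1-e)A(1-e) has finite global dimension and that the Yoneda ring Y(e) is (left and right) Artinian. Then A has finite global dimension. -/
set_option linter.unusedVariables false
set_option maxHeartbeats 1000000

/-! Common setup: corner rings, the simple module `S_e`, Ext-algebras (Yoneda rings),
semiperfect and basic rings, finite global dimension. -/

open CategoryTheory CategoryTheory.Abelian
open scoped DirectSum

noncomputable section

/-- Smallness of Ext groups for module categories. -/
instance hasExtModuleCat (R : Type u) [Ring R] : HasExt.{u + 1} (ModuleCat.{u} R) :=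
  letI := HasDerivedCategory.standard (ModuleCat.{u} R)
  hasExt_of_hasDerivedCategory _

/-! ### Corner rings `eAe` -/

/-- The corner ring `eAe = {x : A | e * x = x ∧ x * e = x}` of an idempotent `e : A`. -/
def CornerRing {A : Type*} [Ring A] (e : A) (_ : IsIdempotentElem e) : Type _ :=
  {x : A // e * x = x ∧ x * e = x}

namespace CornerRing

variable {A : Type*} [Ring A] {e : A} {he : IsIdempotentElem e}

instance : Zero (CornerRing e he) := ⟨⟨0, by simp, by simp⟩⟩
instance : One (CornerRing e he) := ⟨⟨e, he, he⟩⟩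
instance : Add (CornerRing e he) :=
  ⟨fun x y => ⟨x.1 + y.1, by rw [mul_add, x.2.1, y.2.1], by rw [add_mul, x.2.2, y.2.2]⟩⟩
instance : Neg (CornerRing e he) :=
  ⟨fun x => ⟨-x.1, by rw [mul_neg, x.2.1], by rw [neg_mul, x.2.2]⟩⟩
instance : Mul (CornerRing e he) :=
  ⟨fun x y => ⟨x.1 * y.1, by rw [← mul_assoc, x.2.1], by rw [mul_assoc, y.2.2]⟩⟩

instance instRing : Ring (CornerRing e he) where
  add_assoc x y z := Subtype.ext (add_assoc _ _ _)
  zero_add x := Subtype.ext (zero_add _)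
  add_zero x := Subtype.ext (add_zero _)
  add_comm x y := Subtype.ext (add_comm _ _)
  neg_add_cancel x := Subtype.ext (neg_add_cancel _)
  mul_assoc x y z := Subtype.ext (mul_assoc _ _ _)
  one_mul x := Subtype.ext x.2.1
  mul_one x := Subtype.ext x.2.2
  left_distrib x y z := Subtype.ext (left_distrib _ _ _)
  right_distrib x y z := Subtype.ext (right_distrib _ _ _)
  zero_mul x := Subtype.ext (zero_mul _)
  mul_zero x := Subtype.ext (mul_zero _)
  nsmul := nsmulRec
  zsmul := zsmulRec

end CornerRing

/-! ### The semisimple module `S_e = eA / e rad A` -/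

/-- The Jacobson radical of the ring `A`, as a set. -/
def ringRadical (A : Type*) [Ring A] : Set A :=
  ((⊥ : TwoSidedIdeal A).jacobson : Set A)

/-- The right ideal `eA`, as a right `A`-module (i.e. an `Aᵐᵒᵖ`-module). -/
def rightIdeal (A : Type*) [Ring A] (e : A) : Submodule Aᵐᵒᵖ A :=
  Submodule.span Aᵐᵒᵖ {e}

/-- The right submodule `e (rad A)` of `A`. -/
def eRad (A : Type*) [Ring A] (e : A) : Submodule Aᵐᵒᵖ A :=
  Submodule.span Aᵐᵒᵖ ((e * ·) '' ringRadical A)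

/-- The semisimple right `A`-module `S_e = eA / e rad A` associated with an idempotent `e`. -/
def SeModule (A : Type*) [Ring A] (e : A) : Type _ :=
  rightIdeal A e ⧸ (eRad A e).comap (rightIdeal A e).subtype

instance (A : Type*) [Ring A] (e : A) : AddCommGroup (SeModule A e) :=
  inferInstanceAs (AddCommGroup (rightIdeal A e ⧸ (eRad A e).comap (rightIdeal A e).subtype))

instance (A : Type*) [Ring A] (e : A) : Module Aᵐᵒᵖ (SeModule A e) :=
  inferInstanceAs (Module Aᵐᵒᵖ (rightIdeal A e ⧸ (eRad A e).comap (rightIdeal A e).subtype))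

/-- `S_e` as an object of the category of right `A`-modules. -/
def Se (A : Type) [Ring A] (e : A) : ModuleCat Aᵐᵒᵖ :=
  ModuleCat.of Aᵐᵒᵖ (SeModule A e)

/-! ### The Ext-algebra (Yoneda ring) of an object of an abelian category -/

namespace ExtYoneda

universe w v u
variable {C : Type u} [Category.{v} C] [Abelian C] [HasExt.{w} C]

lemma comp_heq {X Y Z : C} {a b c : ℕ} (h : a + b = c) (α : Ext X Y a) (β : Ext Y Z b) :
    HEq (α.comp β rfl) (α.comp β h) := by subst h; rfl

variable (X : C)

def gmul : GradedMonoid.GMul (fun i : ℕ => Ext X X i) where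
  mul {i j} α β := α.comp β rfl

def gone : GradedMonoid.GOne (fun i : ℕ => Ext X X i) where
  one := Ext.mk₀ (𝟙 X)

def gmonoid : GradedMonoid.GMonoid (fun i : ℕ => Ext X X i) :=
  letI := gmul X
  letI := gone X
  { one_mul := fun a => by
      obtain ⟨i, α⟩ := a
      exact Sigma.ext (zero_add i)
        ((comp_heq (zero_add i) _ _).trans (heq_of_eq (Ext.mk₀_id_comp α)))
    mul_one := fun a => by
      obtain ⟨i, α⟩ := a
      exact Sigma.ext (add_zero i)
        ((comp_heq (add_zero i) _ _).trans (heq_of_eq (Ext.comp_mk₀_id α)))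
    mul_assoc := fun a b c => by
      obtain ⟨i, α⟩ := a
      obtain ⟨j, β⟩ := b
      obtain ⟨k, γ⟩ := c
      refine Sigma.ext (add_assoc i j k) ?_
      refine (heq_of_eq (Ext.comp_assoc α β γ rfl rfl rfl)).trans ?_
      exact (comp_heq (h := (add_assoc i j k).symm ▸ rfl) _ _).symm }

/-- The graded ring structure on `fun i => Ext X X i` given by the Yoneda product. -/
def gring : DirectSum.GRing (fun i : ℕ => Ext X X i) :=
  letI := gmonoid X
  { __ := gmonoid X
    mul_zero := fun {i j} α => Ext.comp_zero α _ _ _ rfl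
    zero_mul := fun {i j} β => Ext.zero_comp _ _ β _ rfl
    mul_add := fun {_ _} α β γ => Ext.comp_add _ _ _ rfl
    add_mul := fun {_ _} α β γ => Ext.add_comp _ _ _ rfl
    natCast := fun n => n • Ext.mk₀ (𝟙 X)
    natCast_zero := zero_smul _ _
    natCast_succ := fun n => succ_nsmul _ _
    intCast := fun z => z • Ext.mk₀ (𝟙 X)
    intCast_ofNat := fun n => natCast_zsmul _ _
    intCast_negSucc_ofNat := fun n => negSucc_zsmul _ _ }

end ExtYoneda

/-- The Yoneda (Ext-) ring `⨁ i, Ext X X i` of an object `X` of an abelian category,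
with multiplication induced by the Yoneda product. -/
def ExtRing {C : Type u} [Category.{v} C] [Abelian C] [HasExt.{w} C] (X : C) : Type w :=
  ⨁ i : ℕ, Ext X X i

instance {C : Type u} [Category.{v} C] [Abelian C] [HasExt.{w} C] (X : C) :
    Ring (ExtRing X) :=
  letI := ExtYoneda.gring X
  inferInstanceAs (Ring (⨁ i : ℕ, Ext X X i))

/-- The Yoneda ring `Y(e) = Ext_A^*(S_e, S_e)` of an idempotent `e` of the ring `A`. -/
def YonedaRing (A : Type) [Ring A] (e : A) : Type 1 :=
  ExtRing (Se A e)

instance (A : Type) [Ring A] (e : A) : Ring (YonedaRing A e) :=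
  inferInstanceAs (Ring (ExtRing (Se A e)))

/-! ### Homological and ring-theoretic conditions -/

/-- A ring `R` has finite (right) global dimension if there is a uniform bound `n` such that
`Ext^i(M, N)` vanishes for all right `R`-modules `M`, `N` and all `i > n`. -/
def HasFiniteGlobalDimension (R : Type u) [Ring R] : Prop :=
  ∃ n : ℕ, ∀ (M N : ModuleCat.{u} Rᵐᵒᵖ) (i : ℕ), n < i → Subsingleton (Ext M N i)

/-- A ring is Artinian on both sides. -/
def IsTwoSidedArtinian (R : Type u) [Ring R] : Prop :=
  IsArtinianRing R ∧ IsArtinianRing Rᵐᵒᵖ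

/-- A ring is Noetherian on both sides. -/
def IsTwoSidedNoetherian (R : Type u) [Ring R] : Prop :=
  IsNoetherianRing R ∧ IsNoetherianRing Rᵐᵒᵖ

/-- A ring is semiperfect iff `1` decomposes as a finite sum of pairwise orthogonal
idempotents each of whose corner rings is local. -/
def IsSemiperfectRing (A : Type*) [Ring A] : Prop :=
  ∃ (n : ℕ) (f : Fin n → A) (hf : ∀ i, IsIdempotentElem (f i)),
    (∀ i j, i ≠ j → f i * f j = 0) ∧ (∑ i, f i = 1) ∧
      ∀ i, IsLocalRing (CornerRing (f i) (hf i))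

/-- An idempotent is primitive if it is nonzero and cannot be written as the sum of two
nonzero orthogonal idempotents. -/
def IsPrimitiveIdempotent {A : Type*} [Ring A] (e : A) : Prop :=
  IsIdempotentElem e ∧ e ≠ 0 ∧
    ∀ f g : A, IsIdempotentElem f → IsIdempotentElem g → f * g = 0 → g * f = 0 →
      f + g = e → f = 0 ∨ g = 0

/-- A ring is basic if `1` decomposes as a finite sum of pairwise orthogonal primitive
idempotents whose associated indecomposable projective right modules are pairwise
non-isomorphic. -/
def IsBasicRing (A : Type*) [Ring A] : Prop :=
  ∃ (n : ℕ) (f : Fin n → A),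
    (∀ i, IsPrimitiveIdempotent (f i)) ∧ (∀ i j, i ≠ j → f i * f j = 0) ∧ (∑ i, f i = 1) ∧
      ∀ i j, i ≠ j → IsEmpty ((rightIdeal A (f i)) ≃ₗ[Aᵐᵒᵖ] (rightIdeal A (f j)))

end

/-- Vanishing of `Ext^i(M, N)` for modules. -/
def ExtVan (R : Type) [Ring R] (M N : Type) [AddCommGroup M] [Module R M] [AddCommGroup N]
    [Module R N] (i : ℕ) : Prop :=
  Subsingleton (@Ext _ _ _ (hasExtModuleCat R) (ModuleCat.of R M) (ModuleCat.of R N) i)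

section ExtLemmas

variable {R : Type} [Ring R]
variable {X Y Z N : Type} [AddCommGroup X] [Module R X] [AddCommGroup Y] [Module R Y]
  [AddCommGroup Z] [Module R Z] [AddCommGroup N] [Module R N]

/-- the short complex attached to two composable linear maps -/
abbrev scOf (f : X →ₗ[R] Y) (g : Y →ₗ[R] Z) (h : Function.Exact f g) :
    ShortComplex (ModuleCat.{0} R) :=
  ShortComplex.mk (ModuleCat.ofHom f) (ModuleCat.ofHom g) (by
    ext x; exact (h (f x)).2 ⟨x, rfl⟩)

theorem scOf_shortExact (f : X →ₗ[R] Y) (g : Y →ₗ[R] Z) (h : Function.Exact f g)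
    (hf : Function.Injective f) (hg : Function.Surjective g) : (scOf f g h).ShortExact where
  exact := by
    rw [ShortComplex.moduleCat_exact_iff]
    intro x hx
    exact (h x).1 hx
  mono_f := by
    rw [ModuleCat.mono_iff_injective]; exact hf
  epi_g := by
    rw [ModuleCat.epi_iff_surjective]; exact hg

theorem extVan_zero_iff : ExtVan R X N 0 ↔ ∀ f : X →ₗ[R] N, f = 0 := by
  unfold ExtVan
  rw [Equiv.subsingleton_congr (Ext.homEquiv₀ (X := ModuleCat.of R X) (Y := ModuleCat.of R N))]
  constructor
  · intro h f
    have := Subsingleton.elim (ModuleCat.ofHom f) (ModuleCat.ofHom 0)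
    simpa using congrArg ModuleCat.Hom.hom this
  · intro h
    refine ⟨fun a b => ?_⟩
    ext1
    rw [h a.hom, h b.hom]

/-- contravariant middle term -/
theorem extVan_mid (f : X →ₗ[R] Y) (g : Y →ₗ[R] Z) (h : Function.Exact f g)
    (hf : Function.Injective f) (hg : Function.Surjective g) {i : ℕ}
    (h1 : ExtVan R X N i) (h3 : ExtVan R Z N i) : ExtVan R Y N i := by
  unfold ExtVan at *
  refine subsingleton_of_forall_eq 0 fun x => ?_
  obtain ⟨y, rfl⟩ := Ext.contravariant_sequence_exact₂ (scOf_shortExact f g h hf hg) _ x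
    (Subsingleton.elim _ _)
  have : y = 0 := Subsingleton.elim _ _
  rw [this, Ext.comp_zero]

theorem extVan_shift (f : X →ₗ[R] Y) (g : Y →ₗ[R] Z) (h : Function.Exact f g)
    (hf : Function.Injective f) (hg : Function.Surjective g) [Module.Projective R Y] {i : ℕ}
    (h1 : ExtVan R X N (i + 1)) : ExtVan R Z N (i + 2) := by
  unfold ExtVan at *
  have : Projective (ModuleCat.of R Y) := (IsProjective.iff_projective Y).1 inferInstance
  refine subsingleton_of_forall_eq 0 fun x => ?_
  obtain ⟨y, rfl⟩ := Ext.contravariant_sequence_exact₃ (scOf_shortExact f g h hf hg) _ x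
    (Ext.eq_zero_of_projective _) (n₀ := i + 1) (by omega)
  have : y = 0 := Subsingleton.elim _ _
  rw [this, Ext.comp_zero]

theorem extVan_unshift (f : X →ₗ[R] Y) (g : Y →ₗ[R] Z) (h : Function.Exact f g)
    (hf : Function.Injective f) (hg : Function.Surjective g) [Module.Projective R Y] {i : ℕ}
    (h1 : ExtVan R Z N (i + 2)) : ExtVan R X N (i + 1) := by
  unfold ExtVan at *
  have : Projective (ModuleCat.of R Y) := (IsProjective.iff_projective Y).1 inferInstance
  refine subsingleton_of_forall_eq 0 fun x => ?_
  obtain ⟨y, rfl⟩ := Ext.contravariant_sequence_exact₁ (scOf_shortExact f g h hf hg) _ x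
    (n₁ := i + 2) (by omega) (Subsingleton.elim _ _)
  have : y = 0 := Ext.eq_zero_of_projective _
  rw [this, Ext.comp_zero]

theorem extVan_one (f : X →ₗ[R] Y) (g : Y →ₗ[R] Z) (h : Function.Exact f g)
    (hf : Function.Injective f) (hg : Function.Surjective g) [Module.Projective R Y]
    (h1 : ∀ u : X →ₗ[R] N, ∃ v : Y →ₗ[R] N, v ∘ₗ f = u) : ExtVan R Z N 1 := by
  unfold ExtVan at *
  have : Projective (ModuleCat.of R Y) := (IsProjective.iff_projective Y).1 inferInstance
  refine subsingleton_of_forall_eq 0 fun x => ?_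
  have hS := scOf_shortExact f g h hf hg
  obtain ⟨y, rfl⟩ := Ext.contravariant_sequence_exact₃ hS _ x
    (Ext.eq_zero_of_projective _) (n₀ := 0) (by omega)
  obtain ⟨u, rfl⟩ := (Ext.mk₀_bijective _ _).2 y
  obtain ⟨v, hv⟩ := h1 u.hom
  have hu : u = (scOf f g h).f ≫ ModuleCat.ofHom v := by
    ext1; simpa using hv.symm
  rw [hu, ← Ext.mk₀_comp_mk₀]
  rw [← Ext.comp_assoc _ _ _ (show 1 + 0 = 1 by omega) (by omega) (by omega)]
  rw [hS.extClass_comp, Ext.zero_comp]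

theorem extVan_extend (f : X →ₗ[R] Y) (g : Y →ₗ[R] Z) (h : Function.Exact f g)
    (hf : Function.Injective f) (hg : Function.Surjective g)
    (h1 : ExtVan R Z N 1) (u : X →ₗ[R] N) : ∃ v : Y →ₗ[R] N, v ∘ₗ f = u := by
  unfold ExtVan at *
  have hS := scOf_shortExact f g h hf hg
  obtain ⟨y, hy⟩ := Ext.contravariant_sequence_exact₁ hS _
    (Ext.mk₀ (ModuleCat.ofHom u : ModuleCat.of R X ⟶ ModuleCat.of R N))
    (n₁ := 1) (by omega) (Subsingleton.elim _ _)
  obtain ⟨v, rfl⟩ := (Ext.mk₀_bijective _ _).2 y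
  refine ⟨v.hom, ?_⟩
  rw [Ext.mk₀_comp_mk₀] at hy
  have := (Ext.mk₀_bijective _ _).1 hy
  simpa using congrArg ModuleCat.Hom.hom this

/-! covariant versions -/

theorem extVan_shift' (f : X →ₗ[R] Y) (g : Y →ₗ[R] Z) (h : Function.Exact f g)
    (hf : Function.Injective f) (hg : Function.Surjective g)
    [Injective (ModuleCat.of R Y)] {i : ℕ}
    (h1 : ExtVan R N Z (i + 1)) : ExtVan R N X (i + 2) := by
  unfold ExtVan at *
  refine subsingleton_of_forall_eq 0 fun x => ?_
  obtain ⟨y, rfl⟩ := Ext.covariant_sequence_exact₁ _ (scOf_shortExact f g h hf hg) x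
    (Ext.eq_zero_of_injective _) (n₀ := i + 1) (by omega)
  have : y = 0 := Subsingleton.elim _ _
  rw [this, Ext.zero_comp]

theorem extVan_unshift' (f : X →ₗ[R] Y) (g : Y →ₗ[R] Z) (h : Function.Exact f g)
    (hf : Function.Injective f) (hg : Function.Surjective g)
    [Injective (ModuleCat.of R Y)] {i : ℕ}
    (h1 : ExtVan R N X (i + 2)) : ExtVan R N Z (i + 1) := by
  unfold ExtVan at *
  refine subsingleton_of_forall_eq 0 fun x => ?_
  obtain ⟨y, rfl⟩ := Ext.covariant_sequence_exact₃ _ (scOf_shortExact f g h hf hg) x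
    (n₁ := i + 2) (by omega) (Subsingleton.elim _ _)
  have : y = 0 := Ext.eq_zero_of_injective _
  rw [this, Ext.zero_comp]

theorem extVan_one' (f : X →ₗ[R] Y) (g : Y →ₗ[R] Z) (h : Function.Exact f g)
    (hf : Function.Injective f) (hg : Function.Surjective g)
    [Injective (ModuleCat.of R Y)]
    (h1 : ∀ u : N →ₗ[R] Z, ∃ v : N →ₗ[R] Y, g ∘ₗ v = u) : ExtVan R N X 1 := by
  unfold ExtVan at *
  refine subsingleton_of_forall_eq 0 fun x => ?_
  have hS := scOf_shortExact f g h hf hg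
  obtain ⟨y, rfl⟩ := Ext.covariant_sequence_exact₁ _ hS x
    (Ext.eq_zero_of_injective _) (n₀ := 0) (by omega)
  obtain ⟨u, rfl⟩ := (Ext.mk₀_bijective _ _).2 y
  obtain ⟨v, hv⟩ := h1 u.hom
  have hu : u = ModuleCat.ofHom v ≫ (scOf f g h).g := by
    ext1; simpa using hv.symm
  rw [hu, ← Ext.mk₀_comp_mk₀]
  rw [Ext.comp_assoc _ _ _ (show 0 + 0 = 0 by omega) (show 0 + 1 = 1 by omega) (by omega)]
  rw [hS.comp_extClass, Ext.comp_zero]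

theorem extVan_extend' (f : X →ₗ[R] Y) (g : Y →ₗ[R] Z) (h : Function.Exact f g)
    (hf : Function.Injective f) (hg : Function.Surjective g)
    (h1 : ExtVan R N X 1) (u : N →ₗ[R] Z) : ∃ v : N →ₗ[R] Y, g ∘ₗ v = u := by
  unfold ExtVan at *
  have hS := scOf_shortExact f g h hf hg
  obtain ⟨y, hy⟩ := Ext.covariant_sequence_exact₃ _ hS
    (Ext.mk₀ (ModuleCat.ofHom u : ModuleCat.of R N ⟶ ModuleCat.of R Z))
    (n₁ := 1) (by omega) (Subsingleton.elim _ _)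
  obtain ⟨v, rfl⟩ := (Ext.mk₀_bijective _ _).2 y
  refine ⟨v.hom, ?_⟩
  rw [Ext.mk₀_comp_mk₀] at hy
  have := (Ext.mk₀_bijective _ _).1 hy
  simpa using congrArg ModuleCat.Hom.hom this

/-- From cyclic modules to all modules, by the criterion of Baer. -/
theorem extVan_of_cyclic (n : ℕ) :
    ∀ (N : Type) [AddCommGroup N] [Module R N],
      (∀ (I : Ideal R) (j : ℕ), n + 1 ≤ j → ExtVan R (R ⧸ I) N j) →
      ∀ (M : Type) [AddCommGroup M] [Module R M] (j : ℕ), n + 1 ≤ j → ExtVan R M N j := by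
  induction n with
  | zero =>
    intro N _ _ h M _ _ j hj
    have hB : Module.Baer R N := by
      intro I u
      obtain ⟨v, hv⟩ := extVan_extend I.subtype I.mkQ (by
        intro x; simp) I.injective_subtype I.mkQ_surjective (h I 1 le_rfl) u
      exact ⟨v, fun x hx => by rw [← hv]; rfl⟩
    have hinj : Module.Injective R N := hB.injective
    have : Injective (ModuleCat.of R N) := Module.injective_object_of_injective_module R N
    obtain ⟨j, rfl⟩ : ∃ k, j = k + 1 := ⟨j - 1, by omega⟩
    exact Ext.subsingleton_of_injective _ _ _
  | succ n ih =>
    intro N _ _ h M _ _ j hj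
    let E := Injective.under (ModuleCat.of R N)
    let f : N →ₗ[R] E := (Injective.ι (ModuleCat.of R N)).hom
    have hf : Function.Injective f :=
      (ModuleCat.mono_iff_injective (Injective.ι (ModuleCat.of R N))).1 inferInstance
    have hex : Function.Exact f (LinearMap.range f).mkQ := by
      intro x; simp
    have : Injective (ModuleCat.of R E) := inferInstanceAs (Injective E)
    have key := ih (E ⧸ LinearMap.range f) (fun I j hj => by
      obtain ⟨j, rfl⟩ : ∃ k, j = k + 1 := ⟨j - 1, by omega⟩
      exact extVan_unshift' f _ hex hf (Submodule.mkQ_surjective _) (h I _ (by omega))) M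
    obtain ⟨j, rfl⟩ : ∃ k, j = k + 2 := ⟨j - 2, by omega⟩
    exact extVan_shift' f _ hex hf (Submodule.mkQ_surjective _) (key _ (by omega))

end ExtLemmas

section Artin

theorem ext_eq_zero_of_artinian {C : Type u} [Category.{v} C] [Abelian C] [HasExt.{w} C] (X : C)
    (h : IsArtinianRing (ExtRing X)) : ∃ N : ℕ, ∀ i, N ≤ i → Subsingleton (Ext X X i) := by
  classical
  let _ := ExtYoneda.gring X
  let D : ExtRing X → (⨁ i : ℕ, Ext X X i) := id
  let I : ℕ → Ideal (ExtRing X) := fun n =>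
    { carrier := {x | ∀ i < n, D x i = 0}
      zero_mem' := fun i _ => rfl
      add_mem' := fun {a b} ha hb i hi => by
        change D a i + D b i = 0
        rw [ha i hi, hb i hi, add_zero]
      smul_mem' := fun r x hx k hk => by
        change (D r * D x) k = 0
        rw [DirectSum.mul_eq_sum_support_ghas_mul, DFinsupp.finsetSum_apply]
        refine Finset.sum_eq_zero fun ij _ => ?_
        by_cases hij : ij.1 + ij.2 = k
        · have : D x ij.2 = 0 := hx _ (by omega)
          rw [this]
          have h0 : GradedMonoid.GMul.mul (D r ij.1)
              (0 : Ext X X ij.2) = 0 := DirectSum.GNonUnitalNonAssocSemiring.mul_zero _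
          rw [h0, map_zero]; rfl
        · exact DirectSum.of_eq_of_ne _ _ _ (Ne.symm hij) }
  have hI : Antitone I := by
    intro m n hmn x hx i hi
    exact hx i (lt_of_lt_of_le hi hmn)
  obtain ⟨N, hN⟩ := IsArtinian.monotone_stabilizes (R := ExtRing X) (M := ExtRing X)
    ⟨fun n => OrderDual.toDual (I n), fun m n hmn => hI hmn⟩
  refine ⟨N, fun i hi => subsingleton_of_forall_eq 0 fun x => ?_⟩
  have h1 : I N = I i := hN i hi
  have h2 : I N = I (i + 1) := hN (i + 1) (by omega)
  have hx : (DirectSum.of (fun i : ℕ => Ext X X i) i x : ExtRing X) ∈ I i := by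
    intro j hj
    exact DirectSum.of_eq_of_ne _ _ _ (by omega)
  rw [← h1, h2] at hx
  have := hx i (by omega)
  exact (DirectSum.of_eq_same (β := fun i : ℕ => Ext X X i) i x).symm.trans this

end Artin

section Jac

variable {R : Type} [Ring R]

theorem mem_jac_iff {x : R} : x ∈ Ring.jacobson R ↔ ∀ y, ∃ z, z * y * x + z - 1 = 0 := by
  rw [← Ideal.jacobson_bot, Ideal.mem_jacobson_iff]; rfl

theorem jac_right_inv {x : R} (hx : x ∈ Ring.jacobson R) (y : R) :
    ∃ z, x * y * z + z - 1 = 0 := by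
  have h1 : x * y ∈ Ring.jacobson R := Ideal.mul_mem_right _ _ hx
  obtain ⟨w, hw⟩ := mem_jac_iff.1 h1 1
  have h2 : w * (x * y) ∈ Ring.jacobson R := Ideal.mul_mem_left _ _ h1
  obtain ⟨w', hw'⟩ := mem_jac_iff.1 h2 (-1)
  have e1 : w * (x * y + 1) = 1 := by
    have : w * (x * y + 1) - 1 = w * 1 * (x * y) + w - 1 := by noncomm_ring
    rw [hw] at this; exact sub_eq_zero.1 this
  have e3 : w * (x * y) = 1 - w := by
    rw [eq_sub_iff_add_eq, ← e1]; noncomm_ring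
  have e2 : w' * w = 1 := by
    rw [e3] at hw'
    have : w' * w - 1 = w' * -1 * (1 - w) + w' - 1 := by noncomm_ring
    rw [hw'] at this; exact sub_eq_zero.1 this
  have e4 : x * y + 1 = w' := by
    calc x * y + 1 = (w' * w) * (x * y + 1) := by rw [e2, one_mul]
      _ = w' := by rw [mul_assoc, e1, mul_one]
  refine ⟨w, ?_⟩
  have : x * y * w + w - 1 = (x * y + 1) * w - 1 := by noncomm_ring
  rw [this, e4, e2, sub_self]

theorem op_mem_jac {x : R} (hx : x ∈ Ring.jacobson R) :
    MulOpposite.op x ∈ Ring.jacobson Rᵐᵒᵖ := by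
  rw [mem_jac_iff]
  intro y
  obtain ⟨z, hz⟩ := jac_right_inv hx y.unop
  refine ⟨MulOpposite.op z, MulOpposite.unop_injective ?_⟩
  simpa [mul_assoc] using hz

theorem mem_jac_of_op {x : R} (hx : MulOpposite.op x ∈ Ring.jacobson Rᵐᵒᵖ) :
    x ∈ Ring.jacobson R := by
  rw [mem_jac_iff]
  intro y
  obtain ⟨z, hz⟩ := jac_right_inv hx (MulOpposite.op y)
  refine ⟨z.unop, ?_⟩
  have := congrArg MulOpposite.unop hz
  simpa [mul_assoc] using this

theorem mem_ringRadical {x : R} : x ∈ ringRadical R ↔ x ∈ Ring.jacobson R := by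
  rw [mem_jac_iff]
  unfold ringRadical
  rw [SetLike.mem_coe, TwoSidedIdeal.mem_jacobson_iff]
  rfl

theorem nakayama {M : Type} [AddCommGroup M] [Module R M] [Module.Finite R M]
    (N : Submodule R M) (h : ∀ m : M, m ∈ N ⊔ Ring.jacobson R • (⊤ : Submodule R M)) :
    N = ⊤ := by
  have hf : (⊤ : Submodule R (M ⧸ N)).FG := Module.Finite.fg_top
  have := hf.eq_bot_of_le_jacobson_smul (by
    intro q _
    obtain ⟨m, rfl⟩ := N.mkQ_surjective q
    obtain ⟨a, ha, b, hb, rfl⟩ := Submodule.mem_sup.1 (h m)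
    have h1 : N.mkQ b ∈ (Ring.jacobson R • (⊤ : Submodule R M)).map N.mkQ := ⟨b, hb, rfl⟩
    rw [Submodule.map_smul'', Submodule.map_top, Submodule.range_mkQ] at h1
    have h2 : N.mkQ a = 0 := by simpa using ha
    rw [map_add, h2, zero_add]; exact h1)
  rw [eq_top_iff]
  intro m _
  have h2 : N.mkQ m ∈ (⊤ : Submodule R (M ⧸ N)) := trivial
  rw [this] at h2
  simpa using h2

/-- `f` is a local idempotent. -/
def LocalIdem (f : R) : Prop :=
  f * f = f ∧ ∀ x : R, (∃ y, y * (f * x * f) = f ∧ (f * x * f) * y = f) ∨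
    (∃ y, y * (f - f * x * f) = f ∧ (f - f * x * f) * y = f)

/-- existence of a decomposition of `1` into local idempotents. -/
def SemiPerf (R : Type) [Ring R] : Prop :=
  ∃ (n : ℕ) (f : Fin n → R), (∑ i, f i = 1) ∧ ∀ i, LocalIdem (f i)

theorem semiPerf_of {A : Type} [Ring A] (h : IsSemiperfectRing A) : SemiPerf A := by
  obtain ⟨n, f, hf, _, h1, h2⟩ := h
  refine ⟨n, f, h1, fun i => ⟨hf i, fun x => ?_⟩⟩
  have := h2 i
  let g : CornerRing (f i) (hf i) := ⟨f i * x * f i, by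
    rw [← mul_assoc, ← mul_assoc, hf i], by rw [mul_assoc, hf i]⟩
  rcases IsLocalRing.isUnit_or_isUnit_of_add_one (a := g) (b := 1 - g) (by abel) with hu | hu
  · obtain ⟨u, hu⟩ := hu
    left
    refine ⟨(↑u⁻¹ : CornerRing (f i) (hf i)).1, ?_, ?_⟩
    · have := congrArg Subtype.val u.inv_mul
      rw [hu] at this; exact this
    · have := congrArg Subtype.val u.mul_inv
      rw [hu] at this; exact this
  · obtain ⟨u, hu⟩ := hu
    right
    have e : (u : CornerRing (f i) (hf i)).1 = f i - f i * x * f i := by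
      rw [hu, sub_eq_add_neg, sub_eq_add_neg]; rfl
    refine ⟨(↑u⁻¹ : CornerRing (f i) (hf i)).1, ?_, ?_⟩
    · have := congrArg Subtype.val u.inv_mul
      rw [← e]; exact this
    · have := congrArg Subtype.val u.mul_inv
      rw [← e]; exact this

theorem LocalIdem.op {f : R} (h : LocalIdem f) : LocalIdem (MulOpposite.op f) := by
  refine ⟨by rw [← MulOpposite.op_mul, h.1], fun x => ?_⟩
  rcases h.2 x.unop with ⟨y, h1, h2⟩ | ⟨y, h1, h2⟩
  · left
    exact ⟨.op y, MulOpposite.unop_injective (by simpa [mul_assoc] using h2),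
      MulOpposite.unop_injective (by simpa [mul_assoc] using h1)⟩
  · right
    exact ⟨.op y, MulOpposite.unop_injective (by simpa [mul_assoc] using h2),
      MulOpposite.unop_injective (by simpa [mul_assoc] using h1)⟩

theorem SemiPerf.op (h : SemiPerf R) : SemiPerf Rᵐᵒᵖ := by
  obtain ⟨n, f, h1, h2⟩ := h
  refine ⟨n, fun i => .op (f i), ?_, fun i => (h2 i).op⟩
  apply MulOpposite.unop_injective
  rw [Finset.unop_sum]; simpa using h1

theorem LocalIdem.gen {f : R} (h : LocalIdem f) {v : R} (hv : v * f = v)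
    (hvJ : v ∉ Ring.jacobson R) : ∃ b, b * v = f := by
  by_contra hc
  push Not at hc
  apply hvJ
  rw [mem_jac_iff]
  intro y
  have e : f * -(y * v) * f = -(f * y * v) := by
    rw [mul_assoc, neg_mul, mul_assoc y, hv]; noncomm_ring
  rcases h.2 (-(y * v)) with ⟨w, h1, h2⟩ | ⟨w, h1, h2⟩
  · rw [e] at h1
    refine absurd (Eq.trans ?_ h1) (hc (-(w * f * y)))
    noncomm_ring
  · rw [e] at h1
    refine ⟨1 - y * v * w * f, ?_⟩
    have h3 : w * f + w * f * y * v = f := by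
      refine Eq.trans ?_ h1
      noncomm_ring
    calc (1 - y * v * w * f) * y * v + (1 - y * v * w * f) - 1
        = y * v - y * v * (w * f + w * f * y * v) := by noncomm_ring
      _ = 0 := by rw [h3, mul_assoc, hv, sub_self]

/-- Projective covers of finite modules. -/
theorem exists_cover (hR : SemiPerf R) (M : Type) [AddCommGroup M] [Module R M]
    [Module.Finite R M] : ∃ (P : Type) (_ : AddCommGroup P) (_ : Module R P)
      (_ : Module.Finite R P) (_ : Module.Projective R P) (π : P →ₗ[R] M),
      Function.Surjective π ∧ ∀ x : P, π x = 0 → x ∈ Ring.jacobson R • (⊤ : Submodule R P) := by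
  classical
  obtain ⟨n, f, hsum, hloc⟩ := hR
  let G : Finset M → Prop := fun s =>
    (∀ m ∈ s, ∃ i, f i • m = m) ∧ Submodule.span R (s : Set M) = ⊤
  have hex : ∃ s, G s := by
    obtain ⟨s, hs⟩ := (Module.Finite.fg_top : (⊤ : Submodule R M).FG)
    refine ⟨(s ×ˢ Finset.univ).image fun p => f p.2 • p.1, ?_, ?_⟩
    · intro m hm
      obtain ⟨p, _, rfl⟩ := Finset.mem_image.1 hm
      exact ⟨p.2, by rw [← mul_smul, (hloc p.2).1]⟩
    · rw [eq_top_iff, ← hs, Submodule.span_le]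
      intro m hm
      have : m = ∑ i, f i • m := by rw [← Finset.sum_smul, hsum, one_smul]
      rw [this]
      refine Submodule.sum_mem _ fun i _ => Submodule.subset_span ?_
      simp only [Finset.coe_image, Set.mem_image]
      exact ⟨(m, i), by simpa using hm, rfl⟩
  obtain ⟨s, hs⟩ := exists_minimal_of_wellFoundedLT G hex
  have hmin : ∀ m ∈ s, m ∉ Submodule.span R ((s.erase m : Finset M) : Set M) := by
    intro m hm hmem
    have hG : G (s.erase m) := by
      refine ⟨fun x hx => hs.prop.1 x (Finset.mem_of_mem_erase hx), ?_⟩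
      rw [eq_top_iff, ← hs.prop.2, Submodule.span_le]
      intro x hx
      by_cases hxm : x = m
      · rw [hxm]; exact hmem
      · exact Submodule.subset_span (by simp [hxm]; exact hx)
    have := hs.le_of_le hG (Finset.erase_subset m s)
    exact Finset.notMem_erase m s (this hm)
  have hidx : ∀ m : s, ∃ i, f i • (m : M) = m := fun m => hs.prop.1 m m.2
  choose c hc using hidx
  let E : (s → R) →ₗ[R] (s → R) := LinearMap.pi fun t =>
    (LinearMap.toSpanSingleton R R (f (c t))) ∘ₗ LinearMap.proj t
  have hE : ∀ v t, E v t = v t * f (c t) := fun v t => rfl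
  have hEE : ∀ v, E (E v) = E v := by
    intro v; ext t; rw [hE, hE, mul_assoc, (hloc _).1]
  have hproj : Module.Projective R (LinearMap.range E) :=
    Module.Projective.of_split (LinearMap.range E).subtype E.rangeRestrict (by
      ext x
      obtain ⟨x, v, rfl⟩ := x
      change E (E v) _ = E v _
      rw [hEE])
  let π : (s → R) →ₗ[R] M := ∑ t : s, (LinearMap.toSpanSingleton R M (t : M)) ∘ₗ LinearMap.proj t
  have hπ : ∀ v, π v = ∑ t : s, v t • (t : M) := by
    intro v; simp [π, LinearMap.sum_apply]
  have hsingle : ∀ t : s, Pi.single t (f (c t)) ∈ LinearMap.range E := fun t =>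
    ⟨Pi.single t (f (c t)), by
      ext u
      rw [hE]
      by_cases hu : u = t
      · subst hu; simp [(hloc _).1]
      · simp [Pi.single_eq_of_ne hu]⟩
  refine ⟨LinearMap.range E, inferInstance, inferInstance, inferInstance, hproj,
    π ∘ₗ (LinearMap.range E).subtype, ?_, ?_⟩
  · rw [← LinearMap.range_eq_top, eq_top_iff, ← hs.prop.2, Submodule.span_le]
    intro m hm
    refine ⟨⟨_, hsingle ⟨m, hm⟩⟩, ?_⟩
    change π (Pi.single ⟨m, hm⟩ (f (c ⟨m, hm⟩))) = m
    rw [hπ, Finset.sum_eq_single ⟨m, hm⟩]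
    · simp only [Pi.single_eq_same]; exact hc ⟨m, hm⟩
    · intro b _ hb; rw [Pi.single_eq_of_ne hb, zero_smul]
    · intro h; exact absurd (Finset.mem_univ _) h
  · rintro ⟨x, hx⟩ h0
    have hxE : ∀ t, x t * f (c t) = x t := by
      intro t
      obtain ⟨v, rfl⟩ := hx
      rw [← hE, hEE]
    change π x = 0 at h0
    have hJ : ∀ t, x t ∈ Ring.jacobson R := by
      intro t
      by_contra hcon
      obtain ⟨b, hb⟩ := (hloc (c t)).gen (hxE t) hcon
      apply hmin t t.2
      rw [hπ, ← Finset.add_sum_erase _ _ (Finset.mem_univ t)] at h0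
      have h1 : (t : M) = - ∑ u ∈ Finset.univ.erase t, (b * x u) • (u : M) := by
        have := congrArg (b • ·) h0
        simp only [smul_add, smul_zero, Finset.smul_sum, ← mul_smul, hb, hc] at this
        exact eq_neg_of_add_eq_zero_left this
      have hgoal : - ∑ u ∈ Finset.univ.erase t, (b * x u) • (u : M) ∈
          Submodule.span R ((s.erase (t : M) : Finset M) : Set M) := ?_
      · rw [← h1] at hgoal; exact hgoal
      refine Submodule.neg_mem _ (Submodule.sum_mem _ fun u hu => Submodule.smul_mem _ _
        (Submodule.subset_span ?_))
      have hut : u ≠ t := Finset.ne_of_mem_erase hu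
      simp only [Finset.coe_erase, Set.mem_sdiff, Set.mem_singleton_iff]
      exact ⟨u.2, fun h => hut (Subtype.ext h)⟩
    have hdec : (⟨x, hx⟩ : LinearMap.range E) =
        ∑ t : s, x t • (⟨_, hsingle t⟩ : LinearMap.range E) := by
      apply Subtype.ext
      rw [AddSubmonoidClass.coe_finsetSum]
      ext u
      rw [Finset.sum_apply, Finset.sum_eq_single u]
      · simp [hxE]
      · intro b _ hb; simp [Pi.single_eq_of_ne (Ne.symm hb)]
      · intro h; exact absurd (Finset.mem_univ _) h
    rw [hdec]
    exact Submodule.sum_mem _ fun t _ => Submodule.smul_mem_smul (hJ t) trivial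

end Jac

/-- A ring `G` identified with the corner `f R f` of `R`, where `f` is the image of `1`. -/
structure Corner (R G : Type) [Ring R] [Ring G] where
  ι : G →ₙ+* R
  θ : R →+ G
  inj : Function.Injective ι
  hθ : ∀ a, ι (θ a) = ι 1 * a * ι 1

/-- `M` is generated by its elements fixed by `f`. -/
def Gen {R : Type} [Ring R] (f : R) (M : Type) [AddCommGroup M] [Module R M] : Prop :=
  Submodule.span R {m : M | f • m = m} = ⊤

namespace Corner

variable {R G : Type} [Ring R] [Ring G] (C : Corner R G)

theorem one_mul_ι (g : G) : C.ι 1 * C.ι g = C.ι g := by rw [← map_mul, one_mul]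
theorem ι_mul_one (g : G) : C.ι g * C.ι 1 = C.ι g := by rw [← map_mul, mul_one]

theorem θ_mul (g : G) (a : R) : C.θ (C.ι g * a) = g * C.θ a := by
  apply C.inj
  rw [C.hθ, map_mul, C.hθ]
  simp only [← mul_assoc, one_mul_ι, ι_mul_one]

variable (M : Type) [AddCommGroup M] [Module R M]

/-- The corner module `f M`. -/
def crn : AddSubgroup M where
  carrier := {m | C.ι 1 • m = m}
  zero_mem' := smul_zero _
  add_mem' := fun {a b} ha hb => by
    change _ • _ = _ at ha
    change _ • _ = _ at hb
    change _ • _ = _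
    rw [smul_add, ha, hb]
  neg_mem' := fun {a} ha => by
    change _ • _ = _ at ha
    change _ • _ = _
    rw [smul_neg, ha]

variable {M}
theorem crn_mem {m : M} : m ∈ C.crn M ↔ C.ι 1 • m = m := Iff.rfl
theorem crn_prop (m : C.crn M) : C.ι 1 • (m : M) = m := m.2

theorem smul_mem (g : G) (m : M) : C.ι g • m ∈ C.crn M := by
  rw [crn_mem, ← mul_smul, one_mul_ι]

instance : Module G (C.crn M) where
  smul g m := ⟨C.ι g • (m : M), C.smul_mem g (m : M)⟩
  one_smul m := Subtype.ext (by exact m.2)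
  mul_smul a b m := Subtype.ext (by
    change C.ι (a * b) • (m : M) = C.ι a • C.ι b • (m : M)
    rw [map_mul, mul_smul])
  smul_zero a := Subtype.ext (smul_zero _)
  smul_add a m n := Subtype.ext (smul_add _ _ _)
  add_smul a b m := Subtype.ext (by
    change C.ι (a + b) • (m : M) = C.ι a • (m : M) + C.ι b • (m : M)
    rw [map_add, add_smul])
  zero_smul m := Subtype.ext (by
    change C.ι 0 • (m : M) = 0
    rw [map_zero, zero_smul])

theorem coe_smul (g : G) (m : C.crn M) : ((g • m : C.crn M) : M) = C.ι g • (m : M) := rfl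

variable {N : Type} [AddCommGroup N] [Module R N]
variable {P : Type} [AddCommGroup P] [Module R P]

/-- functoriality of the corner module -/
def cmap (h : M →ₗ[R] N) : C.crn M →ₗ[G] C.crn N where
  toFun m := ⟨h m, by rw [crn_mem, ← map_smul, crn_prop]⟩
  map_add' a b := Subtype.ext (map_add h _ _)
  map_smul' g m := Subtype.ext (map_smul h _ _)

theorem coe_cmap (h : M →ₗ[R] N) (m : C.crn M) : (C.cmap h m : N) = h m := rfl

theorem coe_lc {I : Type} (h : I → C.crn M) (t : I →₀ R) :
    (Finsupp.linearCombination G h (t.mapRange C.θ (map_zero _)) : M) =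
      C.ι 1 • Finsupp.linearCombination R (fun i => (h i : M)) t := by
  induction t using Finsupp.induction_linear with
  | zero => simp
  | add a b ha hb =>
    rw [Finsupp.mapRange_add (map_add _), map_add, map_add, smul_add, ← ha, ← hb]; rfl
  | single i a =>
    rw [Finsupp.mapRange_single, Finsupp.linearCombination_single,
      Finsupp.linearCombination_single, coe_smul, C.hθ, mul_smul, crn_prop, mul_smul]

theorem exists_section [Module.Projective R P] (hG : Gen (C.ι 1) P) :
    ∃ s : P →ₗ[R] (C.crn P →₀ R), ∀ x,
      Finsupp.linearCombination R (fun i : C.crn P => (i : P)) (s x) = x := by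
  have hs : Function.Surjective (Finsupp.linearCombination R (fun i : C.crn P => (i : P))) := by
    rw [← LinearMap.range_eq_top, Finsupp.range_linearCombination]
    refine Eq.trans ?_ hG
    congr 1
    ext x
    exact ⟨fun ⟨y, hy⟩ => hy ▸ y.2, fun h => ⟨⟨x, h⟩, rfl⟩⟩
  obtain ⟨s, hs⟩ := Module.projective_lifting_property _ LinearMap.id hs
  exact ⟨s, fun x => LinearMap.congr_fun hs x⟩

theorem extendE [Module.Projective R P] (hG : Gen (C.ι 1) P) (r : C.crn P →ₗ[G] C.crn N) :
    ∃ ρ : P →ₗ[R] N, ∀ x : C.crn P, ρ x = r x := by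
  obtain ⟨s, hs⟩ := C.exists_section hG
  refine ⟨Finsupp.linearCombination R (fun i => (r i : N)) ∘ₗ s, fun x => ?_⟩
  have h1 : C.ι 1 • s x = s x := by rw [← map_smul, crn_prop]
  have h2 : Finsupp.linearCombination G id ((s x).mapRange C.θ (map_zero _)) = x := by
    apply Subtype.ext
    rw [coe_lc]
    refine (congrArg (C.ι 1 • ·) (hs x)).trans (C.crn_prop x)
  have h3 : r (Finsupp.linearCombination G id ((s x).mapRange C.θ (map_zero _))) =
      Finsupp.linearCombination G r ((s x).mapRange C.θ (map_zero _)) := by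
    rw [Finsupp.apply_linearCombination]; rfl
  rw [h2] at h3
  rw [h3, coe_lc, LinearMap.comp_apply, ← map_smul, h1]

theorem projective_crn [Module.Projective R P] (hG : Gen (C.ι 1) P) :
    Module.Projective G (C.crn P) := by
  obtain ⟨s, hs⟩ := C.exists_section hG
  rw [Module.projective_def']
  refine ⟨{ toFun := fun x => (s x).mapRange C.θ (map_zero _), map_add' := fun x y => ?_,
            map_smul' := fun g x => ?_ }, ?_⟩
  · rw [AddSubgroup.coe_add, map_add, Finsupp.mapRange_add (map_add _)]
  · rw [coe_smul, map_smul]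
    ext i
    simp [C.θ_mul]
  · ext x
    change ((Finsupp.linearCombination G id ((s x).mapRange C.θ (map_zero _)) : C.crn P) : P) = x
    rw [coe_lc]
    exact (congrArg (C.ι 1 • ·) (hs x)).trans (C.crn_prop x)

section Exact
variable (ρ : P →ₗ[R] M)

theorem crn_inj : Function.Injective (C.cmap (LinearMap.ker ρ).subtype) := by
  intro a b h
  have := congrArg Subtype.val h
  exact Subtype.ext (Subtype.ext this)

theorem crn_exact : Function.Exact (C.cmap (LinearMap.ker ρ).subtype) (C.cmap ρ) := by
  intro x
  constructor
  · intro h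
    have hx : ρ x = 0 := congrArg Subtype.val h
    exact ⟨⟨⟨x, hx⟩, Subtype.ext (C.crn_prop x)⟩, rfl⟩
  · rintro ⟨y, rfl⟩
    exact Subtype.ext y.1.2

theorem crn_surj (hρ : ∀ m, C.ι 1 • m = m → ∃ p, ρ p = m) :
    Function.Surjective (C.cmap ρ) := by
  intro m
  obtain ⟨p, hp⟩ := hρ m m.2
  refine ⟨⟨C.ι 1 • p, C.smul_mem 1 p⟩, Subtype.ext ?_⟩
  rw [coe_cmap, map_smul, hp, crn_prop]

theorem splitExt [Module.Projective R P] (hG : Gen (C.ι 1) P)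
    (hρ : ∀ m, C.ι 1 • m = m → ∃ p, ρ p = m)
    (hM : ExtVan G (C.crn M) (C.crn (LinearMap.ker ρ)) 1)
    (hN : ∀ k : LinearMap.ker ρ →ₗ[R] N, (∀ x, C.ι 1 • x = x → k x = 0) → k = 0)
    (u : LinearMap.ker ρ →ₗ[R] N) :
    ∃ v : P →ₗ[R] N, v ∘ₗ (LinearMap.ker ρ).subtype = u := by
  obtain ⟨r, hr⟩ := extVan_extend _ _ (C.crn_exact ρ) (C.crn_inj ρ) (C.crn_surj ρ hρ) hM
    LinearMap.id
  obtain ⟨v, hv⟩ := C.extendE hG (C.cmap u ∘ₗ r)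
  refine ⟨v, ?_⟩
  rw [← sub_eq_zero]
  apply hN
  intro x hx
  have h1 := hv (C.cmap (LinearMap.ker ρ).subtype ⟨x, hx⟩)
  have h2 : r (C.cmap (LinearMap.ker ρ).subtype ⟨x, hx⟩) = ⟨x, hx⟩ :=
    LinearMap.congr_fun hr ⟨x, hx⟩
  rw [LinearMap.comp_apply, h2] at h1
  rw [LinearMap.sub_apply, sub_eq_zero]
  exact h1

end Exact

end Corner

section RR

variable {R : Type} [Ring R]

theorem homJ {P T : Type} [AddCommGroup P] [Module R P] [AddCommGroup T] [Module R T]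
    (hT : ∀ a ∈ Ring.jacobson R, ∀ t : T, a • t = 0) (h : P →ₗ[R] T) {x : P}
    (hx : x ∈ Ring.jacobson R • (⊤ : Submodule R P)) : h x = 0 := by
  induction hx using Submodule.smul_induction_on' with
  | smul a ha m _ => rw [map_smul, hT a ha]
  | add a _ b _ ha hb => rw [map_add, ha, hb, add_zero]

theorem gen_cover {P M : Type} [AddCommGroup P] [Module R P] [AddCommGroup M] [Module R M]
    [Module.Finite R P] (π : P →ₗ[R] M) (hπ : Function.Surjective π)
    (hk : ∀ x : P, π x = 0 → x ∈ Ring.jacobson R • (⊤ : Submodule R P)) {f : R} (hf : f * f = f)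
    (hM : Gen f M) : Gen f P := by
  apply nakayama
  intro p
  have h1 : Submodule.span R {m : M | f • m = m} ≤
      (Submodule.span R {m : P | f • m = m}).map π := by
    rw [Submodule.span_le]
    intro m hm
    obtain ⟨q, rfl⟩ := hπ m
    refine ⟨f • q, Submodule.subset_span (by
      change f • f • q = f • q
      rw [← mul_smul, hf]), ?_⟩
    rw [map_smul]; exact hm
  rw [hM] at h1
  obtain ⟨t, ht, h2⟩ := h1 (trivial : π p ∈ ⊤)
  have : p = t + (p - t) := by abel
  rw [this]
  exact Submodule.add_mem_sup ht (hk _ (by rw [map_sub, h2, sub_self]))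

/-- vanishing of all `Ext^j` with `j ≥ i`. -/
def PdLT (G : Type) [Ring G] (X : Type) [AddCommGroup X] [Module G X] (i : ℕ) : Prop :=
  ∀ (N : Type) [AddCommGroup N] [Module G N] (j : ℕ), i ≤ j → ExtVan G X N j

theorem ker_exact {P M : Type} [AddCommGroup P] [Module R P] [AddCommGroup M] [Module R M]
    (π : P →ₗ[R] M) : Function.Exact (LinearMap.ker π).subtype π := by
  intro x
  exact ⟨fun h => ⟨⟨x, h⟩, rfl⟩, fun ⟨y, hy⟩ => hy ▸ y.2⟩

theorem pd_ker {G : Type} [Ring G] (C : Corner R G) {P M : Type} [AddCommGroup P] [Module R P]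
    [AddCommGroup M] [Module R M] [Module.Projective R P] (ρ : P →ₗ[R] M)
    (hG : Gen (C.ι 1) P) (hρ : ∀ m, C.ι 1 • m = m → ∃ p, ρ p = m) {i : ℕ}
    (h : PdLT G (C.crn M) (i + 2)) : PdLT G (C.crn (LinearMap.ker ρ)) (i + 1) := by
  intro N _ _ j hj
  have := C.projective_crn hG
  obtain ⟨j, rfl⟩ : ∃ k, j = k + 1 := ⟨j - 1, by omega⟩
  exact extVan_unshift _ _ (C.crn_exact ρ) (C.crn_inj ρ) (C.crn_surj ρ hρ) (h N _ (by omega))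

theorem hom_ker_zero {P M T : Type} [AddCommGroup P] [Module R P]
    [AddCommGroup M] [Module R M] [AddCommGroup T] [Module R T]
    (hT : ∀ a ∈ Ring.jacobson R, ∀ t : T, a • t = 0)
    (π : P →ₗ[R] M) (hπ : Function.Surjective π)
    (hk : ∀ x : P, π x = 0 → x ∈ Ring.jacobson R • (⊤ : Submodule R P))
    (h : ExtVan R M T 1) (u : LinearMap.ker π →ₗ[R] T) : u = 0 := by
  obtain ⟨v, rfl⟩ := extVan_extend _ _ (ker_exact π) (Submodule.subtype_injective _) hπ h u
  ext x
  exact homJ hT v (hk x x.2)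

variable {G : Type} [Ring G]

theorem lemR0
    (C : Corner R G) (hR : SemiPerf R) [IsNoetherianRing R]
    {T : Type} [AddCommGroup T] [Module R T]
    (hT : ∀ a ∈ Ring.jacobson R, ∀ t : T, a • t = 0)
    (hTG : ∀ (X : Type) [AddCommGroup X] [Module R X] [Module.Finite R X],
      (∀ u : X →ₗ[R] T, u = 0) → Gen (C.ι 1) X)
    (i : ℕ) : ∀ (M : Type) [AddCommGroup M] [Module R M] [Module.Finite R M],
    (∀ j, ExtVan R M T j) → PdLT G (C.crn M) (i + 1) →
    ∀ (N : Type) [AddCommGroup N] [Module R N], ExtVan R M N (i + 1) := by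
  induction i with
  | zero =>
    intro M _ _ _ hM hpd N _ _
    have hGM := hTG M (extVan_zero_iff.1 (hM 0))
    obtain ⟨P, _, _, _, _, π, hπ, hk⟩ := exists_cover hR M
    have hGP := gen_cover π hπ hk (C.one_mul_ι 1) hGM
    have hGK := hTG _ (hom_ker_zero hT π hπ hk (hM 1))
    refine extVan_one _ _ (ker_exact π) (Submodule.subtype_injective _) hπ ?_
    refine C.splitExt π hGP (fun m _ => hπ m) (hpd _ 1 (by omega)) ?_
    intro k hk0
    have : LinearMap.ker k = ⊤ := by
      rw [eq_top_iff, ← hGK, Submodule.span_le]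
      exact fun x hx => hk0 x hx
    exact LinearMap.ker_eq_top.1 this
  | succ i ih =>
    intro M _ _ _ hM hpd N _ _
    have hGM := hTG M (extVan_zero_iff.1 (hM 0))
    obtain ⟨P, _, _, _, _, π, hπ, hk⟩ := exists_cover hR M
    have hGP := gen_cover π hπ hk (C.one_mul_ι 1) hGM
    refine extVan_shift _ _ (ker_exact π) (Submodule.subtype_injective _) hπ ?_
    refine ih (LinearMap.ker π) ?_ (pd_ker C π hGP (fun m _ => hπ m) hpd) N
    rintro (_ | j)
    · exact extVan_zero_iff.2 (hom_ker_zero hT π hπ hk (hM 1))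
    · exact extVan_unshift _ _ (ker_exact π) (Submodule.subtype_injective _) hπ (hM (j + 2))

theorem lemR1
    (C : Corner R G) (hR : SemiPerf R) [IsNoetherianRing R]
    {T : Type} [AddCommGroup T] [Module R T]
    (hT : ∀ a ∈ Ring.jacobson R, ∀ t : T, a • t = 0)
    (hTG : ∀ (X : Type) [AddCommGroup X] [Module R X] [Module.Finite R X],
      (∀ u : X →ₗ[R] T, u = 0) → Gen (C.ι 1) X)
    {g : ℕ} (hg : ∀ (X : Type) [AddCommGroup X] [Module G X], PdLT G X (g + 1))
    (n : ℕ) : ∀ (M : Type) [AddCommGroup M] [Module R M] [Module.Finite R M],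
    (∀ j, n ≤ j → ExtVan R M T j) → PdLT R M (n + g + 1) := by
  induction n with
  | zero =>
    intro M _ _ _ hM N _ _ j hj
    obtain ⟨j, rfl⟩ : ∃ k, j = k + 1 := ⟨j - 1, by omega⟩
    refine lemR0 C hR hT hTG j M (fun j => hM j (Nat.zero_le _)) ?_ N
    intro Y _ _ l hl
    exact hg _ Y l (by omega)
  | succ n ih =>
    intro M _ _ _ hM N _ _ j hj
    obtain ⟨j, rfl⟩ : ∃ k, j = k + 2 := ⟨j - 2, by omega⟩
    obtain ⟨P, _, _, _, _, π, hπ, hk⟩ := exists_cover hR M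
    refine extVan_shift _ _ (ker_exact π) (Submodule.subtype_injective _) hπ ?_
    refine ih (LinearMap.ker π) ?_ N (j + 1) (by omega)
    rintro (_ | l) hl
    · exact extVan_zero_iff.2 (hom_ker_zero hT π hπ hk (hM 1 (by omega)))
    · exact extVan_unshift _ _ (ker_exact π) (Submodule.subtype_injective _) hπ
        (hM (l + 2) (by omega))

end RR

/-! ### Character duals -/

noncomputable section Dual

/-- the target of characters -/
abbrev QZ : Type := AddCircle (1 : ℚ)

theorem char_extend {X Y : Type} [AddCommGroup X] [AddCommGroup Y] (f : X →+ Y)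
    (hf : Function.Injective f) (c : X →+ QZ) : ∃ d : Y →+ QZ, d.comp f = c :=
  (Module.Baer.of_divisible QZ).extension_property_addMonoidHom f hf c

theorem char_zero {X : Type} [AddCommGroup X] {x : X} (h : ∀ c : X →+ QZ, c x = 0) : x = 0 :=
  CharacterModule.eq_zero_of_character_apply (A := X) fun c => h c

/-- characters of a left module, a right module -/
def DL (A L : Type) [Ring A] [AddCommGroup L] [Module A L] : Type := L →+ QZ

/-- characters of a right module, a left module -/
def DR (A X : Type) [Ring A] [AddCommGroup X] [Module Aᵐᵒᵖ X] : Type := X →+ QZ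

variable {A : Type} [Ring A]

instance (L : Type) [AddCommGroup L] [Module A L] : AddCommGroup (DL A L) :=
  inferInstanceAs (AddCommGroup (L →+ QZ))

instance (L : Type) [AddCommGroup L] [Module Aᵐᵒᵖ L] : AddCommGroup (DR A L) :=
  inferInstanceAs (AddCommGroup (L →+ QZ))

/-- evaluation -/
def DL.ev {L : Type} [AddCommGroup L] [Module A L] : DL A L →+ (L →+ QZ) := AddMonoidHom.id _
/-- inverse of evaluation -/
def DL.mk {L : Type} [AddCommGroup L] [Module A L] : (L →+ QZ) →+ DL A L := AddMonoidHom.id _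

/-- evaluation -/
def DR.ev {L : Type} [AddCommGroup L] [Module Aᵐᵒᵖ L] : DR A L →+ (L →+ QZ) :=
  AddMonoidHom.id _
/-- inverse of evaluation -/
def DR.mk {L : Type} [AddCommGroup L] [Module Aᵐᵒᵖ L] : (L →+ QZ) →+ DR A L :=
  AddMonoidHom.id _

theorem DL.ev_mk {L : Type} [AddCommGroup L] [Module A L] (c : L →+ QZ) :
    DL.ev (DL.mk c : DL A L) = c := rfl
theorem DR.ev_mk {L : Type} [AddCommGroup L] [Module Aᵐᵒᵖ L] (c : L →+ QZ) :
    DR.ev (DR.mk c : DR A L) = c := rfl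

theorem DL.ext {L : Type} [AddCommGroup L] [Module A L] {c d : DL A L}
    (h : ∀ x, DL.ev c x = DL.ev d x) : c = d := AddMonoidHom.ext (f := c) (g := d) h
theorem DR.ext {L : Type} [AddCommGroup L] [Module Aᵐᵒᵖ L] {c d : DR A L}
    (h : ∀ x, DR.ev c x = DR.ev d x) : c = d := AddMonoidHom.ext (f := c) (g := d) h

instance (L : Type) [AddCommGroup L] [Module A L] : SMul Aᵐᵒᵖ (DL A L) where
  smul a c := DL.mk ((DL.ev c).comp (DistribSMul.toAddMonoidHom L a.unop))

instance (L : Type) [AddCommGroup L] [Module Aᵐᵒᵖ L] : SMul A (DR A L) where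
  smul a c := DR.mk ((DR.ev c).comp (DistribSMul.toAddMonoidHom L (MulOpposite.op a)))

theorem DL.ev_smul {L : Type} [AddCommGroup L] [Module A L] (a : Aᵐᵒᵖ) (c : DL A L) (x : L) :
    DL.ev (a • c) x = DL.ev c (a.unop • x) := rfl
theorem DR.ev_smul {L : Type} [AddCommGroup L] [Module Aᵐᵒᵖ L] (a : A) (c : DR A L) (x : L) :
    DR.ev (a • c) x = DR.ev c (MulOpposite.op a • x) := rfl

instance (L : Type) [AddCommGroup L] [Module A L] : Module Aᵐᵒᵖ (DL A L) where
  one_smul c := DL.ext fun x => by rw [DL.ev_smul, MulOpposite.unop_one, one_smul]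
  mul_smul a b c := DL.ext fun x => by
    rw [DL.ev_smul, DL.ev_smul, DL.ev_smul, MulOpposite.unop_mul, mul_smul]
  smul_zero a := rfl
  smul_add a c d := rfl
  add_smul a b c := DL.ext fun x => by
    rw [DL.ev_smul, MulOpposite.unop_add, add_smul, map_add, map_add]; rfl
  zero_smul c := DL.ext fun x => by
    rw [DL.ev_smul, MulOpposite.unop_zero, zero_smul, map_zero, map_zero]; rfl

instance (L : Type) [AddCommGroup L] [Module Aᵐᵒᵖ L] : Module A (DR A L) where
  one_smul c := DR.ext fun x => by rw [DR.ev_smul, MulOpposite.op_one, one_smul]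
  mul_smul a b c := DR.ext fun x => by
    rw [DR.ev_smul, DR.ev_smul, DR.ev_smul, MulOpposite.op_mul, mul_smul]
  smul_zero a := rfl
  smul_add a c d := rfl
  add_smul a b c := DR.ext fun x => by
    rw [DR.ev_smul, MulOpposite.op_add, add_smul, map_add, map_add]; rfl
  zero_smul c := DR.ext fun x => by
    rw [DR.ev_smul, MulOpposite.op_zero, zero_smul, map_zero, map_zero]; rfl

/-- duals of maps -/
def DL.map {L K : Type} [AddCommGroup L] [Module A L] [AddCommGroup K] [Module A K]
    (h : L →ₗ[A] K) : DL A K →ₗ[Aᵐᵒᵖ] DL A L where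
  toFun c := DL.mk ((DL.ev c).comp h.toAddMonoidHom)
  map_add' c d := rfl
  map_smul' a c := DL.ext fun x => by
    change DL.ev c (a.unop • h x) = DL.ev c (h (a.unop • x))
    rw [map_smul h]

theorem DL.ev_map {L K : Type} [AddCommGroup L] [Module A L] [AddCommGroup K] [Module A K]
    (h : L →ₗ[A] K) (c : DL A K) (x : L) : DL.ev (DL.map h c) x = DL.ev c (h x) := rfl

/-- duals of maps -/
def DR.map {L K : Type} [AddCommGroup L] [Module Aᵐᵒᵖ L] [AddCommGroup K] [Module Aᵐᵒᵖ K]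
    (h : L →ₗ[Aᵐᵒᵖ] K) : DR A K →ₗ[A] DR A L where
  toFun c := DR.mk ((DR.ev c).comp h.toAddMonoidHom)
  map_add' c d := rfl
  map_smul' a c := DR.ext fun x => by
    change DR.ev c (MulOpposite.op a • h x) = DR.ev c (h (MulOpposite.op a • x))
    rw [map_smul h]

theorem DR.ev_map {L K : Type} [AddCommGroup L] [Module Aᵐᵒᵖ L] [AddCommGroup K]
    [Module Aᵐᵒᵖ K]
    (h : L →ₗ[Aᵐᵒᵖ] K) (c : DR A K) (x : L) : DR.ev (DR.map h c) x = DR.ev c (h x) := rfl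

theorem DR.map_surj {L K : Type} [AddCommGroup L] [Module Aᵐᵒᵖ L] [AddCommGroup K]
    [Module Aᵐᵒᵖ K] (h : L →ₗ[Aᵐᵒᵖ] K) (hh : Function.Injective h) :
    Function.Surjective (DR.map h) := by
  intro c
  obtain ⟨d, hd⟩ := char_extend h.toAddMonoidHom hh (DR.ev c)
  exact ⟨DR.mk d, DR.ext fun x => DFunLike.congr_fun hd x⟩

theorem DL.map_surj {L K : Type} [AddCommGroup L] [Module A L] [AddCommGroup K]
    [Module A K] (h : L →ₗ[A] K) (hh : Function.Injective h) :
    Function.Surjective (DL.map h) := by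
  intro c
  obtain ⟨d, hd⟩ := char_extend h.toAddMonoidHom hh (DL.ev c)
  exact ⟨DL.mk d, DL.ext fun x => DFunLike.congr_fun hd x⟩

theorem DL.map_inj {L K : Type} [AddCommGroup L] [Module A L] [AddCommGroup K]
    [Module A K] (h : L →ₗ[A] K) (hh : Function.Surjective h) :
    Function.Injective (DL.map h) := by
  intro c d hcd
  refine DL.ext fun x => ?_
  obtain ⟨y, rfl⟩ := hh x
  rw [← DL.ev_map, hcd, DL.ev_map]

theorem DL.map_exact {L Q : Type} [AddCommGroup L] [Module A L] [AddCommGroup Q]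
    [Module A Q] (h : Q →ₗ[A] L) (hh : Function.Surjective h) :
    Function.Exact (DL.map h) (DL.map (LinearMap.ker h).subtype) := by
  intro c
  constructor
  · intro hc
    have h1 : h.toAddMonoidHom.ker ≤ (DL.ev c).ker := by
      intro x hx
      have : DL.ev (DL.map (LinearMap.ker h).subtype c) ⟨x, hx⟩ = 0 := by rw [hc]; rfl
      exact this
    refine ⟨DL.mk (AddMonoidHom.liftOfSurjective h.toAddMonoidHom hh ⟨DL.ev c, h1⟩), ?_⟩
    refine DL.ext fun x => ?_
    exact AddMonoidHom.liftOfRightInverse_comp_apply h.toAddMonoidHom _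
      (Function.rightInverse_surjInv hh) ⟨DL.ev c, h1⟩ x
  · rintro ⟨d, rfl⟩
    refine DL.ext fun x => ?_
    rw [DL.ev_map, DL.ev_map, show h ((LinearMap.ker h).subtype x) = 0 from x.2, map_zero]
    rfl

theorem DL.injective (Q : Type) [AddCommGroup Q] [Module A Q] [Module.Projective A Q] :
    Injective (ModuleCat.of Aᵐᵒᵖ (DL A Q)) := by
  rw [← Module.injective_iff_injective_object]
  refine ⟨fun X Y _ _ _ _ f hf g => ?_⟩
  let t : Q →ₗ[A] DR A X :=
    { toFun := fun q => DR.mk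
        { toFun := fun x => DL.ev (g x) q
          map_zero' := by rw [map_zero, map_zero]; rfl
          map_add' := fun x y => by rw [map_add, map_add]; rfl }
      map_add' := fun p q => DR.ext fun x => map_add (DL.ev (g x)) p q
      map_smul' := fun a q => DR.ext fun x => by
        change DL.ev (g x) (a • q) = DL.ev (g (MulOpposite.op a • x)) q
        rw [map_smul g, DL.ev_smul]; rfl }
  obtain ⟨s, hs⟩ := Module.projective_lifting_property (DR.map f) t (DR.map_surj f hf)
  refine ⟨{ toFun := fun y => DL.mk
              { toFun := fun q => DR.ev (s q) y
                map_zero' := by rw [map_zero, map_zero]; rfl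
                map_add' := fun p q => by rw [map_add, map_add]; rfl }
            map_add' := fun x y => DL.ext fun q => map_add (DR.ev (s q)) x y
            map_smul' := fun a y => DL.ext fun q => ?_ }, fun x => DL.ext fun q => ?_⟩
  · change DR.ev (s q) (a • y) = DR.ev (s (a.unop • q)) y
    rw [map_smul s, DR.ev_smul]; rfl
  · change DR.ev (s q) (f x) = DL.ev (g x) q
    rw [← DR.ev_map]
    exact congrArg (fun c => DR.ev c x) (LinearMap.congr_fun hs q)

/-- a map to the dual of a generated module vanishing on the corner is zero -/
theorem hom_DL_zero {f : A} {K : Type} [AddCommGroup K] [Module A K] (hK : Gen f K)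
    {X : Type} [AddCommGroup X] [Module Aᵐᵒᵖ X] (hf : f * f = f) (k : X →ₗ[Aᵐᵒᵖ] DL A K)
    (h : ∀ x, MulOpposite.op f • x = x → k x = 0) : k = 0 := by
  have key : ∀ y ∈ Submodule.span A {m : K | f • m = m}, ∀ x, DL.ev (k x) y = 0 := by
    intro y hy
    induction hy using Submodule.span_induction with
    | mem y hy =>
      intro x
      have h1 : k (MulOpposite.op f • x) = 0 := h _ (by
        rw [← mul_smul, ← MulOpposite.op_mul, hf])
      rw [map_smul] at h1
      have h2 : DL.ev (MulOpposite.op f • k x) y = 0 := by rw [h1]; rfl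
      rw [DL.ev_smul] at h2
      change DL.ev (k x) (f • y) = 0 at h2
      rwa [show f • y = y from hy] at h2
    | zero => intro x; exact map_zero _
    | add a b _ _ ha hb => intro x; rw [map_add, ha, hb, add_zero]
    | smul a y _ hy =>
      intro x
      have := hy (MulOpposite.op a • x)
      rw [map_smul, DL.ev_smul] at this
      exact this
  ext x
  refine DL.ext fun y => ?_
  exact key y (by rw [hK]; trivial) x

variable {S : Type} [AddCommGroup S] [Module Aᵐᵒᵖ S]

theorem hom_DL_ker_zero (hS : ∀ a ∈ Ring.jacobson Aᵐᵒᵖ, ∀ s : S, a • s = 0)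
    {Q L : Type} [AddCommGroup Q] [Module A Q] [AddCommGroup L] [Module A L]
    (π : Q →ₗ[A] L) (hπ : Function.Surjective π)
    (hk : ∀ x : Q, π x = 0 → x ∈ Ring.jacobson A • (⊤ : Submodule A Q))
    (h : ExtVan Aᵐᵒᵖ S (DL A L) 1) (u : S →ₗ[Aᵐᵒᵖ] DL A (LinearMap.ker π)) : u = 0 := by
  obtain ⟨v, rfl⟩ := extVan_extend' _ _ (DL.map_exact π hπ) (DL.map_inj π hπ)
    (DL.map_surj _ (Submodule.subtype_injective _)) h u
  ext s
  refine DL.ext fun x => ?_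
  change DL.ev (v s) x.1 = 0
  have hx := hk x.1 x.2
  generalize x.1 = y at hx
  induction hx using Submodule.smul_induction_on' with
  | smul a ha m _ =>
    have : DL.ev (v (MulOpposite.op a • s)) m = DL.ev (v s) (a • m) := by
      rw [map_smul, DL.ev_smul]; rfl
    rw [← this, hS _ (op_mem_jac ha), map_zero]; rfl
  | add a _ b _ ha hb => rw [map_add, ha, hb, add_zero]

variable {f : A}

theorem lemL1
    (hf : f * f = f) (hA : SemiPerf A) [IsNoetherianRing A]
    (hS : ∀ a ∈ Ring.jacobson Aᵐᵒᵖ, ∀ s : S, a • s = 0)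
    (hSG : ∀ (K : Type) [AddCommGroup K] [Module A K] [Module.Finite A K],
      (∀ u : S →ₗ[Aᵐᵒᵖ] DL A K, u = 0) → Gen f K)
    (i : ℕ) : ∀ (K : Type) [AddCommGroup K] [Module A K] [Module.Finite A K],
    (∀ j, ExtVan Aᵐᵒᵖ S (DL A K) j) →
    ∀ (X : Type) [AddCommGroup X] [Module Aᵐᵒᵖ X],
      (∀ x : X, MulOpposite.op f • x = x → x = 0) → ExtVan Aᵐᵒᵖ X (DL A K) i := by
  have base : ∀ (K : Type) [AddCommGroup K] [Module A K] [Module.Finite A K],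
    (ExtVan Aᵐᵒᵖ S (DL A K) 0) →
    ∀ (X : Type) [AddCommGroup X] [Module Aᵐᵒᵖ X],
      (∀ x : X, MulOpposite.op f • x = x → x = 0) → ExtVan Aᵐᵒᵖ X (DL A K) 0 := by
    intro K _ _ _ hK X _ _ hX
    refine extVan_zero_iff.2 fun u => ?_
    refine hom_DL_zero (hSG K (extVan_zero_iff.1 hK)) hf u fun x hx => ?_
    rw [hX x hx, map_zero]
  induction i with
  | zero =>
    intro K _ _ _ hK X _ _ hX
    exact base K (hK 0) X hX
  | succ i ih =>
    intro K _ _ _ hK X _ _ hX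
    obtain ⟨Q, _, _, _, _, π, hπ, hk⟩ := exists_cover hA K
    have := DL.injective (A := A) Q
    have h0 : ExtVan Aᵐᵒᵖ S (DL A (LinearMap.ker π)) 0 :=
      extVan_zero_iff.2 (hom_DL_ker_zero hS π hπ hk (hK 1))
    rcases i with _ | i
    · refine extVan_one' _ _ (DL.map_exact π hπ) (DL.map_inj π hπ)
        (DL.map_surj _ (Submodule.subtype_injective _)) fun u => ⟨0, ?_⟩
      rw [extVan_zero_iff.1 (base _ h0 X hX) u, LinearMap.comp_zero]
    · refine extVan_shift' _ _ (DL.map_exact π hπ) (DL.map_inj π hπ)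
        (DL.map_surj _ (Submodule.subtype_injective _)) (ih _ ?_ X hX)
      rintro (_ | j)
      · exact h0
      · exact extVan_unshift' _ _ (DL.map_exact π hπ) (DL.map_inj π hπ)
          (DL.map_surj _ (Submodule.subtype_injective _)) (hK (j + 2))

/-- the trace submodule -/
abbrev trM {R : Type} [Ring R] (f : R) (M : Type) [AddCommGroup M] [Module R M] :
    Submodule R M := Submodule.span R {m : M | f • m = m}

theorem gen_trM {R : Type} [Ring R] (f : R) (M : Type) [AddCommGroup M] [Module R M] :
    Gen f (trM f M) := by
  unfold Gen
  rw [eq_top_iff]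
  rintro ⟨x, hx⟩ -
  induction hx using Submodule.span_induction with
  | mem y hy => exact Submodule.subset_span (Subtype.ext hy)
  | zero => exact Submodule.zero_mem _
  | add a b ha hb h1 h2 => exact Submodule.add_mem _ h1 h2
  | smul a y hy h => exact Submodule.smul_mem _ a h

variable {G : Type} [Ring G]

theorem lemL2
    (hf : f * f = f) (hA : SemiPerf A) [IsNoetherianRing A] [IsNoetherianRing Aᵐᵒᵖ]
    (hS : ∀ a ∈ Ring.jacobson Aᵐᵒᵖ, ∀ s : S, a • s = 0)
    (hSG : ∀ (K : Type) [AddCommGroup K] [Module A K] [Module.Finite A K],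
      (∀ u : S →ₗ[Aᵐᵒᵖ] DL A K, u = 0) → Gen f K)
    (C : Corner Aᵐᵒᵖ G) (hC : C.ι 1 = MulOpposite.op f)
    (K : Type) [AddCommGroup K] [Module A K] [Module.Finite A K]
    (hK : ∀ j, ExtVan Aᵐᵒᵖ S (DL A K) j) (i : ℕ) :
    ∀ (M : Type) [AddCommGroup M] [Module Aᵐᵒᵖ M] [Module.Finite Aᵐᵒᵖ M],
      PdLT G (C.crn M) (i + 1) → ExtVan Aᵐᵒᵖ M (DL A K) (i + 1) := by
  have red : ∀ (M : Type) [AddCommGroup M] [Module Aᵐᵒᵖ M] (j : ℕ),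
      ExtVan Aᵐᵒᵖ (trM (MulOpposite.op f) M) (DL A K) j → ExtVan Aᵐᵒᵖ M (DL A K) j := by
    intro M _ _ j h
    refine extVan_mid (trM (MulOpposite.op f) M).subtype (trM (MulOpposite.op f) M).mkQ ?_
      (Submodule.subtype_injective _) (Submodule.mkQ_surjective _) h ?_
    · intro x
      simp
    · refine lemL1 hf hA hS hSG j K hK _ ?_
      intro q hq
      obtain ⟨m, rfl⟩ := Submodule.mkQ_surjective _ q
      rw [← hq, ← map_smul, Submodule.mkQ_apply, Submodule.Quotient.mk_eq_zero]
      refine Submodule.subset_span ?_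
      change _ • _ = _
      rw [← mul_smul, ← MulOpposite.op_mul, hf]
  have hGK : Gen f K := hSG K (extVan_zero_iff.1 (hK 0))
  induction i with
  | zero =>
    intro M _ _ _ hpd
    apply red
    obtain ⟨P, _, _, _, _, π, hπ, hk⟩ := exists_cover hA.op (trM (MulOpposite.op f) M)
    have hGP : Gen (C.ι 1) P := by
      rw [hC]
      exact gen_cover π hπ hk (by rw [← MulOpposite.op_mul, hf]) (gen_trM _ M)
    let ρ : P →ₗ[Aᵐᵒᵖ] M := (trM (MulOpposite.op f) M).subtype ∘ₗ π
    have hex : Function.Exact (LinearMap.ker ρ).subtype π := by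
      intro x
      exact ⟨fun h => ⟨⟨x, congrArg Subtype.val h⟩, rfl⟩, fun ⟨y, hy⟩ => hy ▸ Subtype.ext y.2⟩
    have hρ : ∀ m, C.ι 1 • m = m → ∃ p, ρ p = m := by
      intro m hm
      obtain ⟨p, hp⟩ := hπ ⟨m, Submodule.subset_span (hC ▸ hm)⟩
      exact ⟨p, congrArg Subtype.val hp⟩
    refine extVan_one _ _ hex (Submodule.subtype_injective _) hπ ?_
    refine C.splitExt ρ hGP hρ (hpd _ 1 (by omega)) ?_
    rw [hC]
    exact fun k h => hom_DL_zero hGK hf k h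
  | succ i ih =>
    intro M _ _ _ hpd
    apply red
    obtain ⟨P, _, _, _, _, π, hπ, hk⟩ := exists_cover hA.op (trM (MulOpposite.op f) M)
    have hGP : Gen (C.ι 1) P := by
      rw [hC]
      exact gen_cover π hπ hk (by rw [← MulOpposite.op_mul, hf]) (gen_trM _ M)
    let ρ : P →ₗ[Aᵐᵒᵖ] M := (trM (MulOpposite.op f) M).subtype ∘ₗ π
    have hex : Function.Exact (LinearMap.ker ρ).subtype π := by
      intro x
      exact ⟨fun h => ⟨⟨x, congrArg Subtype.val h⟩, rfl⟩, fun ⟨y, hy⟩ => hy ▸ Subtype.ext y.2⟩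
    have hρ : ∀ m, C.ι 1 • m = m → ∃ p, ρ p = m := by
      intro m hm
      obtain ⟨p, hp⟩ := hπ ⟨m, Submodule.subset_span (hC ▸ hm)⟩
      exact ⟨p, congrArg Subtype.val hp⟩
    refine extVan_shift _ _ hex (Submodule.subtype_injective _) hπ ?_
    exact ih (LinearMap.ker ρ) (pd_ker C ρ hGP hρ hpd)

theorem lemL3
    (hf : f * f = f) (hA : SemiPerf A) [IsNoetherianRing A] [IsNoetherianRing Aᵐᵒᵖ]
    (hS : ∀ a ∈ Ring.jacobson Aᵐᵒᵖ, ∀ s : S, a • s = 0)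
    (hSG : ∀ (K : Type) [AddCommGroup K] [Module A K] [Module.Finite A K],
      (∀ u : S →ₗ[Aᵐᵒᵖ] DL A K, u = 0) → Gen f K)
    (C : Corner Aᵐᵒᵖ G) (hC : C.ι 1 = MulOpposite.op f)
    {g : ℕ} (hg : ∀ (X : Type) [AddCommGroup X] [Module G X], PdLT G X (g + 1))
    (n : ℕ) : ∀ (L : Type) [AddCommGroup L] [Module A L] [Module.Finite A L],
    (∀ j, n ≤ j → ExtVan Aᵐᵒᵖ S (DL A L) j) →
    ∀ (M : Type) [AddCommGroup M] [Module Aᵐᵒᵖ M] [Module.Finite Aᵐᵒᵖ M] (j : ℕ),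
      n + g + 1 ≤ j → ExtVan Aᵐᵒᵖ M (DL A L) j := by
  induction n with
  | zero =>
    intro L _ _ _ hL M _ _ _ j hj
    obtain ⟨j, rfl⟩ : ∃ k, j = k + 1 := ⟨j - 1, by omega⟩
    refine lemL2 hf hA hS hSG C hC L (fun j => hL j (Nat.zero_le _)) j M ?_
    intro Y _ _ l hl
    exact hg _ Y l (by omega)
  | succ n ih =>
    intro L _ _ _ hL M _ _ _ j hj
    obtain ⟨j, rfl⟩ : ∃ k, j = k + 2 := ⟨j - 2, by omega⟩
    obtain ⟨Q, _, _, _, _, π, hπ, hk⟩ := exists_cover hA L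
    have := DL.injective (A := A) Q
    refine extVan_shift' _ _ (DL.map_exact π hπ) (DL.map_inj π hπ)
        (DL.map_surj _ (Submodule.subtype_injective _)) (ih _ ?_ M (j + 1) (by omega))
    rintro (_ | l) hl
    · exact extVan_zero_iff.2 (hom_DL_ker_zero hS π hπ hk (hL 1 (by omega)))
    · exact extVan_unshift' _ _ (DL.map_exact π hπ) (DL.map_inj π hπ)
        (DL.map_surj _ (Submodule.subtype_injective _)) (hL (l + 2) (by omega))

end Dual

/-! ### The semisimple modules attached to `e` -/

section Cyc

variable {R : Type} [Ring R]

theorem liftCyc {T U : Type} [AddCommGroup T] [Module R T] [AddCommGroup U] [Module R U]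
    (t : T) (ht : ∀ s : T, ∃ r : R, r • t = s) (c : U) (h : ∀ r : R, r • t = 0 → r • c = 0) :
    ∃ u : T →ₗ[R] U, u t = c := by
  have hs : Function.Surjective (LinearMap.toSpanSingleton R T t) := fun s => by
    obtain ⟨r, hr⟩ := ht s
    exact ⟨r, hr⟩
  refine ⟨(LinearMap.ker (LinearMap.toSpanSingleton R T t)).liftQ
    (LinearMap.toSpanSingleton R U c) (fun r hr => h r hr) ∘ₗ
    ((LinearMap.toSpanSingleton R T t).quotKerEquivOfSurjective hs).symm.toLinearMap, ?_⟩
  have h1 : ((LinearMap.toSpanSingleton R T t).quotKerEquivOfSurjective hs).symm t =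
      Submodule.Quotient.mk 1 := by
    rw [LinearEquiv.symm_apply_eq]
    change t = (1 : R) • t
    rw [one_smul]
  rw [LinearMap.comp_apply, LinearEquiv.coe_coe, h1]
  change (1 : R) • c = c
  rw [one_smul]

/-- `T` is the semisimple top of `R ε`. -/
structure IsTopOf (ε : R) (T : Type) [AddCommGroup T] [Module R T] (t : T) : Prop where
  gen : ∀ s : T, ∃ r : R, r • t = s
  zero_iff : ∀ r : R, r • t = 0 ↔ r * ε ∈ Ring.jacobson R

theorem IsTopOf.finite {ε : R} {T : Type} [AddCommGroup T] [Module R T] {t : T}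
    (h : IsTopOf ε T t) : Module.Finite R T := by
  refine Module.Finite.of_surjective (LinearMap.toSpanSingleton R T t) fun s => ?_
  obtain ⟨r, hr⟩ := h.gen s
  exact ⟨r, hr⟩

theorem IsTopOf.jac {ε : R} {T : Type} [AddCommGroup T] [Module R T] {t : T}
    (h : IsTopOf ε T t) : ∀ a ∈ Ring.jacobson R, ∀ s : T, a • s = 0 := by
  intro a ha s
  obtain ⟨r, rfl⟩ := h.gen s
  rw [← mul_smul, h.zero_iff]
  exact Ideal.mul_mem_right _ _ (Ideal.mul_mem_right _ _ ha)

/-- if every `ε x` lies in the radical, `X` is generated by `(1-ε) X` -/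
theorem gen_of_mem {X : Type} [AddCommGroup X] [Module R X] [Module.Finite R X] {ε : R}
    (hε : ε * ε = ε) (h : ∀ x : X, ε • x ∈ Ring.jacobson R • (⊤ : Submodule R X)) :
    Gen (1 - ε) X := by
  apply nakayama
  intro x
  have : x = (1 - ε) • x + ε • x := by rw [← add_smul]; simp
  rw [this]
  refine Submodule.add_mem_sup (Submodule.subset_span ?_) (h x)
  change (1 - ε) • (1 - ε) • x = (1 - ε) • x
  rw [← mul_smul]
  congr 1
  simp [mul_sub, sub_mul, hε]

theorem IsTopOf.hTG {ε : R} {T : Type} [AddCommGroup T] [Module R T] {t : T}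
    (h : IsTopOf ε T t) (hε : ε * ε = ε) (hR : SemiPerf R) (X : Type) [AddCommGroup X] [Module R X]
    [Module.Finite R X] (hX : ∀ u : X →ₗ[R] T, u = 0) : Gen (1 - ε) X := by
  by_contra hG
  obtain ⟨N, hN, hle⟩ := (eq_top_or_exists_le_coatom
    (Submodule.span R {m : X | (1 - ε) • m = m})).resolve_left hG
  obtain ⟨n, φ, hsum, hloc⟩ := hR
  have hsimple : IsSimpleModule R (X ⧸ N) := by
    rwa [isSimpleModule_iff_isCoatom]
  obtain ⟨y, hy⟩ : ∃ y : X ⧸ N, y ≠ 0 := by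
    have : Nontrivial (X ⧸ N) := IsSimpleModule.nontrivial R _
    exact exists_ne 0
  obtain ⟨i, hi⟩ : ∃ i, φ i • y ≠ 0 := by
    by_contra hc
    push Not at hc
    apply hy
    rw [← one_smul R y, ← hsum, Finset.sum_smul]
    exact Finset.sum_eq_zero fun i _ => hc i
  generalize hx : φ i • y = x at hi
  have hφx : φ i • x = x := by rw [← hx, ← mul_smul, (hloc i).1]
  have hεx : ε • x = x := by
    obtain ⟨z, rfl⟩ := N.mkQ_surjective x
    have h1 : N.mkQ ((1 - ε) • z) = 0 := by
      rw [Submodule.mkQ_apply, Submodule.Quotient.mk_eq_zero]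
      refine hle (Submodule.subset_span ?_)
      change (1 - ε) • (1 - ε) • z = (1 - ε) • z
      rw [← mul_smul]
      congr 1
      simp [mul_sub, sub_mul, hε]
    rw [map_smul, sub_smul, one_smul, sub_eq_zero] at h1
    exact h1.symm
  have hJ : ∀ a ∈ Ring.jacobson R, a • x = 0 := by
    intro a ha
    have hbot : Ring.jacobson R ≤ Module.annihilator R (X ⧸ N) :=
      IsSemisimpleModule.jacobson_le_annihilator R _
    exact Module.mem_annihilator.1 (hbot ha) x
  have hgenx : ∀ s : X ⧸ N, ∃ r : R, r • x = s :=
    IsSimpleModule.toSpanSingleton_surjective R hi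
  obtain ⟨b, hb⟩ := (hloc i).gen (v := ε * φ i) (by rw [mul_assoc, (hloc i).1]) (by
    intro hv
    apply hi
    have := hJ _ hv
    rwa [mul_smul, hφx, hεx] at this)
  obtain ⟨u, hu⟩ := liftCyc x hgenx (φ i • b • t) (by
    intro r hr
    rw [← mul_smul]
    refine h.jac _ ?_ _
    by_contra hcon
    obtain ⟨b', hb'⟩ := (hloc i).gen (v := r * φ i) (by rw [mul_assoc, (hloc i).1]) hcon
    apply hi
    rw [← hφx, ← hb', mul_smul, mul_smul, hφx, hr, smul_zero])
  have h0 := hX (u ∘ₗ N.mkQ)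
  obtain ⟨z, hz⟩ := N.mkQ_surjective x
  have h1 : φ i • b • t = 0 := by
    rw [← hu, ← hz]
    exact LinearMap.congr_fun h0 z
  rw [← mul_smul, h.zero_iff] at h1
  have h2 : φ i ∈ Ring.jacobson R := by
    have h3 : φ i * b * ε * φ i ∈ Ring.jacobson R := Ideal.mul_mem_right _ _ h1
    rwa [mul_assoc, mul_assoc, hb, (hloc i).1] at h3
  exact hi (by rw [← hφx, hJ _ h2])

end Cyc

section Top2

variable {A : Type} [Ring A]

theorem IsTopOf.hSG {e : A} (he : e * e = e) {S : Type} [AddCommGroup S] [Module Aᵐᵒᵖ S] {t : S}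
    (h : IsTopOf (MulOpposite.op e) S t) (K : Type) [AddCommGroup K] [Module A K]
    [Module.Finite A K] (hK : ∀ u : S →ₗ[Aᵐᵒᵖ] DL A K, u = 0) : Gen (1 - e) K := by
  refine gen_of_mem he fun k => ?_
  rw [← Submodule.Quotient.mk_eq_zero]
  refine char_zero fun χ => ?_
  let q : K →ₗ[A] (K ⧸ Ring.jacobson A • (⊤ : Submodule A K)) := Submodule.mkQ _
  let c : DL A K := DL.mk ((χ.comp q.toAddMonoidHom).comp (DistribSMul.toAddMonoidHom K e))
  have hc : ∀ k, DL.ev c k = χ (q (e • k)) := fun _ => rfl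
  obtain ⟨u, hu⟩ := liftCyc t h.gen c (by
    intro r hr
    rw [h.zero_iff] at hr
    refine DL.ext fun k => ?_
    have h1 : e * r.unop ∈ Ring.jacobson A := mem_jac_of_op hr
    rw [DL.ev_smul, hc, ← mul_smul]
    have : q ((e * r.unop) • k) = 0 := by
      rw [Submodule.mkQ_apply, Submodule.Quotient.mk_eq_zero]
      exact Submodule.smul_mem_smul h1 trivial
    rw [this, map_zero]; rfl)
  have h0 : c = 0 := by rw [← hu, hK u]; rfl
  have := hc k
  rw [h0] at this
  exact this.symm

theorem IsTopOf.hTG_dual {e : A} (he : e * e = e) {L : Type} [AddCommGroup L] [Module A L] {t : L}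
    (h : IsTopOf e L t) (X : Type) [AddCommGroup X] [Module Aᵐᵒᵖ X]
    [Module.Finite Aᵐᵒᵖ X] (hX : ∀ u : X →ₗ[Aᵐᵒᵖ] DL A L, u = 0) :
    Gen (1 - MulOpposite.op e) X := by
  refine gen_of_mem (by rw [← MulOpposite.op_mul, he]) fun k => ?_
  rw [← Submodule.Quotient.mk_eq_zero]
  refine char_zero fun χ => ?_
  let q : X →ₗ[Aᵐᵒᵖ] (X ⧸ Ring.jacobson Aᵐᵒᵖ • (⊤ : Submodule Aᵐᵒᵖ X)) := Submodule.mkQ _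
  let c : DR A X := DR.mk ((χ.comp q.toAddMonoidHom).comp
    (DistribSMul.toAddMonoidHom X (MulOpposite.op e)))
  have hc : ∀ k, DR.ev c k = χ (q (MulOpposite.op e • k)) := fun _ => rfl
  obtain ⟨v, hv⟩ := liftCyc t h.gen c (by
    intro r hr
    rw [h.zero_iff] at hr
    refine DR.ext fun k => ?_
    have h1 : MulOpposite.op (r * e) ∈ Ring.jacobson Aᵐᵒᵖ := op_mem_jac hr
    rw [DR.ev_smul, hc, ← mul_smul, ← MulOpposite.op_mul]
    have : q (MulOpposite.op (r * e) • k) = 0 := by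
      rw [Submodule.mkQ_apply, Submodule.Quotient.mk_eq_zero]
      exact Submodule.smul_mem_smul h1 trivial
    rw [this, map_zero]; rfl)
  let u : X →ₗ[Aᵐᵒᵖ] DL A L :=
    { toFun := fun y => DL.mk
        { toFun := fun q => DR.ev (v q) y
          map_zero' := by rw [map_zero, map_zero]; rfl
          map_add' := fun p q => by rw [map_add, map_add]; rfl }
      map_add' := fun x y => DL.ext fun q => map_add (DR.ev (v q)) x y
      map_smul' := fun a y => DL.ext fun q => by
        change DR.ev (v q) (a • y) = DR.ev (v (a.unop • q)) y
        rw [map_smul v, DR.ev_smul]; rfl }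
  have h0 : DL.ev (u k) t = 0 := by rw [hX u]; rfl
  have h1 : DL.ev (u k) t = DR.ev (v t) k := rfl
  rw [h1, hv, hc] at h0
  exact h0

theorem IsTopOf.jac_dual {e : A} {L : Type} [AddCommGroup L] [Module A L] {t : L}
    (h : IsTopOf e L t) : ∀ a ∈ Ring.jacobson Aᵐᵒᵖ, ∀ s : DL A L, a • s = 0 := by
  intro a ha s
  refine DL.ext fun x => ?_
  rw [DL.ev_smul, h.jac a.unop (mem_jac_of_op ha), map_zero]; rfl

theorem exists_top (e : A) : ∃ (L : Type) (_ : AddCommGroup L) (_ : Module A L) (t : L),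
    IsTopOf e L t := by
  let I : Ideal A := Submodule.comap (LinearMap.toSpanSingleton A A e) (Ring.jacobson A)
  refine ⟨A ⧸ I, inferInstance, inferInstance, Submodule.Quotient.mk 1, ?_, ?_⟩
  · intro s
    obtain ⟨r, rfl⟩ := I.mkQ_surjective s
    exact ⟨r, by rw [← Submodule.Quotient.mk_smul, smul_eq_mul, mul_one]; rfl⟩
  · intro r
    rw [← Submodule.Quotient.mk_smul, Submodule.Quotient.mk_eq_zero, smul_eq_mul, mul_one]
    rfl

theorem exists_top_Se (e : A) (he : e * e = e) :
    ∃ t : SeModule A e, IsTopOf (MulOpposite.op e) (SeModule A e) t := by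
  let e' : rightIdeal A e := ⟨e, Submodule.subset_span rfl⟩
  let q : rightIdeal A e →ₗ[Aᵐᵒᵖ] SeModule A e :=
    Submodule.mkQ ((eRad A e).comap (rightIdeal A e).subtype)
  have hq : Function.Surjective q := Submodule.mkQ_surjective _
  refine ⟨q e', ?_, ?_⟩
  · intro s
    obtain ⟨⟨y, hy⟩, rfl⟩ := hq s
    obtain ⟨a, rfl⟩ := Submodule.mem_span_singleton.1 hy
    exact ⟨a, by rw [← map_smul]; rfl⟩
  · intro r
    have h1 : r • q e' = 0 ↔ e * r.unop ∈ eRad A e := by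
      rw [← map_smul]
      exact Submodule.Quotient.mk_eq_zero _
    rw [h1]
    constructor
    · intro h
      have h2 : ∀ x ∈ eRad A e, x ∈ Ring.jacobson A := by
        intro x hx
        induction hx using Submodule.span_induction with
        | mem x hx =>
          obtain ⟨j, hj, rfl⟩ := hx
          exact Ideal.mul_mem_left _ _ (mem_ringRadical.1 hj)
        | zero => exact Submodule.zero_mem _
        | add a b _ _ ha hb => exact Submodule.add_mem _ ha hb
        | smul a y _ hy => exact Ideal.mul_mem_right a.unop _ hy
      exact op_mem_jac (h2 _ h)
    · intro h
      have h2 : e * r.unop ∈ Ring.jacobson A := mem_jac_of_op h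
      refine Submodule.subset_span ⟨e * r.unop, mem_ringRadical.2 h2, ?_⟩
      change e * (e * r.unop) = e * r.unop
      rw [← mul_assoc, he]

/-- the corner of the opposite ring -/
def opCorner (f : A) (hf : IsIdempotentElem f) : Corner Aᵐᵒᵖ (CornerRing f hf)ᵐᵒᵖ where
  ι := { toFun := fun g => MulOpposite.op g.unop.1
         map_mul' := fun a b => rfl
         map_zero' := rfl
         map_add' := fun a b => rfl }
  θ := { toFun := fun a => MulOpposite.op ⟨f * a.unop * f, by
           rw [← mul_assoc, ← mul_assoc, hf], by rw [mul_assoc, hf]⟩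
         map_zero' := MulOpposite.unop_injective (Subtype.ext (by
           change f * 0 * f = 0
           simp))
         map_add' := fun a b => MulOpposite.unop_injective (Subtype.ext (by
           change f * (a.unop + b.unop) * f = f * a.unop * f + f * b.unop * f
           rw [mul_add, add_mul])) }
  inj := fun a b h => MulOpposite.unop_injective (Subtype.ext (MulOpposite.op_injective h))
  hθ := fun a => MulOpposite.unop_injective (by
    change f * a.unop * f = f * (a.unop * f)
    rw [mul_assoc])

end Top2

/-- **Proposition.** Let `A` be a Noetherian semiperfect basic ring and `e` an idempotent.
If `Γ = (1-e)A(1-e)` has finite global dimension and the Yoneda ring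
`Y(e) = Ext_A^*(S_e, S_e)` is (left and right) Artinian, then `A` has finite global
dimension. -/
theorem hasFiniteGlobalDimension_of_corner_of_artinian_yonedaRing
    (A : Type) [Ring A] (hNoeth : IsTwoSidedNoetherian A)
    (hsemi : IsSemiperfectRing A) (hbasic : IsBasicRing A)
    (e : A) (he : IsIdempotentElem e)
    (hGamma : HasFiniteGlobalDimension (CornerRing (1 - e) he.one_sub))
    (hYart : IsTwoSidedArtinian (YonedaRing A e)) :
    HasFiniteGlobalDimension A := by
  have hA : SemiPerf A := semiPerf_of hsemi
  have := hNoeth.1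
  have := hNoeth.2
  obtain ⟨g, hg⟩ := hGamma
  have hg' : ∀ (X : Type) [AddCommGroup X] [Module (CornerRing (1 - e) he.one_sub)ᵐᵒᵖ X],
      PdLT (CornerRing (1 - e) he.one_sub)ᵐᵒᵖ X (g + 1) :=
    fun X _ _ N _ _ j hj => hg (ModuleCat.of _ X) (ModuleCat.of _ N) j (by omega)
  obtain ⟨N, hN⟩ := ext_eq_zero_of_artinian (Se A e) hYart.1
  let C := opCorner (1 - e) he.one_sub
  have hC : C.ι 1 = MulOpposite.op (1 - e) := rfl
  have hC' : C.ι 1 = 1 - MulOpposite.op e := rfl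
  have hee : MulOpposite.op e * MulOpposite.op e = MulOpposite.op e := by
    rw [← MulOpposite.op_mul, he]
  obtain ⟨t, ht⟩ := exists_top_Se e he
  obtain ⟨L, _, _, l, hl⟩ := exists_top e
  have := ht.finite
  have := hl.finite
  have h1 : PdLT Aᵐᵒᵖ (SeModule A e) (N + g + 1) :=
    lemR1 C hA.op ht.jac (fun X _ _ _ hX => ht.hTG hee hA.op X hX) hg' N (SeModule A e)
      (fun j hj => hN j hj)
  have h2 := lemL3 he.one_sub hA ht.jac (fun K _ _ _ hK => ht.hSG he K hK) C hC hg'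
    (N + g + 1) L (fun j hj => h1 _ j hj)
  have h3 : ∀ (M : Type) [AddCommGroup M] [Module Aᵐᵒᵖ M] [Module.Finite Aᵐᵒᵖ M],
      PdLT Aᵐᵒᵖ M (N + g + 1 + g + 1 + g + 1) := fun M _ _ _ =>
    lemR1 C hA.op hl.jac_dual (fun X _ _ _ hX => hl.hTG_dual he X hX) hg' _ M
      (fun j hj => h2 M j hj)
  refine ⟨N + g + 1 + g + 1 + g, fun M K i hi => ?_⟩
  exact extVan_of_cyclic (N + g + 1 + g + 1 + g) K (fun I j hj => h3 _ K j hj) M i hi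
end

section
/- If A has finite global dimension and e is a primitive idempotent of A with Ext^i_A(S_e, S_e) = 0 for all i > 0, then Γ := (1-e)A(1-e) has finite global dimension. -/
set_option linter.unusedVariables false
set_option maxHeartbeats 1000000

/-! Common setup: corner rings, the simple module `S_e`, Ext-algebras (Yoneda rings),
semiperfect and basic rings, finite global dimension. -/

open CategoryTheory CategoryTheory.Abelian
open scoped DirectSum

section Helpers

open MulOpposite

lemma lemL {A : Type} [Ring A] (hsemi : IsSemiperfectRing A) {e : A}
    (he : IsPrimitiveIdempotent e) {x : A} (hex : e * x = x) (hx : x ∉ ringRadical A) :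
    ∃ a, x * a = e := by
  obtain ⟨n, g, hg, -, hsum, hloc⟩ := hsemi
  have hx' : x ∉ (⊥ : Ideal A).jacobson := by
    intro h
    apply hx
    show x ∈ (⊥ : TwoSidedIdeal A).jacobson
    rw [TwoSidedIdeal.mem_jacobson_iff]
    exact fun y => (Ideal.mem_jacobson_iff.1 h y)
  simp only [Ideal.jacobson, Submodule.mem_sInf, not_forall] at hx'
  obtain ⟨M, ⟨-, hM⟩, hxM⟩ := hx'
  change Ideal A at M
  have h1 : ∃ i, x * g i ∉ M := by
    by_contra! h
    apply hxM
    have : x = ∑ i, x * g i := by rw [← Finset.mul_sum, hsum, mul_one]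
    rw [this]
    exact M.sum_mem fun i _ => h i
  obtain ⟨i, hi⟩ := h1
  obtain ⟨b, hb⟩ : ∃ b, g i - b * (x * g i) ∈ M := by
    by_contra! h
    have h2 : M ⊔ Ideal.span {x * g i} = ⊤ := by
      apply hM.1.2
      apply lt_of_le_of_ne le_sup_left
      intro h3
      apply hi
      rw [h3]
      exact Ideal.mem_sup_right (Ideal.subset_span rfl)
    have h4 : g i ∈ M ⊔ Ideal.span {x * g i} := by rw [h2]; trivial
    obtain ⟨m, hm, y, hy, hmy⟩ := Submodule.mem_sup.1 h4
    obtain ⟨c, rfl⟩ := Ideal.mem_span_singleton'.1 hy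
    apply h c
    rw [sub_eq_of_eq_add hmy.symm]; exact hm
  have hgg : g i * g i = g i := hg i
  let w : CornerRing (g i) (hg i) := ⟨g i * b * e * x * g i,
    by simp only [← mul_assoc, hgg], by simp only [mul_assoc, hgg]⟩
  have hw : IsUnit w := by
    have := hloc i
    have h5 : w + (1 - w) = 1 := by abel
    rcases IsLocalRing.isUnit_or_isUnit_of_add_one h5 with h | h
    · exact h
    · exfalso
      obtain ⟨v, hv⟩ := h.exists_left_inv
      have hv' : v.1 * (g i - g i * b * e * x * g i) = g i := by
        have := congrArg Subtype.val hv
        rw [sub_eq_add_neg] at this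
        rw [sub_eq_add_neg]
        exact this
      have h6 : g i ∈ M := by
        rw [← hv']
        apply M.mul_mem_left
        have : g i - g i * b * e * x * g i = g i * (g i - b * (x * g i)) := by
          rw [mul_sub, hgg]; simp only [mul_assoc]; rw [← mul_assoc e x, hex]
        rw [this]
        exact M.mul_mem_left _ hb
      exact hi (M.mul_mem_left _ h6)
  obtain ⟨v, hwv, hvw⟩ := isUnit_iff_exists.1 hw
  replace hwv : (g i * b * e * x * g i) * v.1 = g i := congrArg Subtype.val hwv
  replace hvw : v.1 * (g i * b * e * x * g i) = g i := congrArg Subtype.val hvw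
  have hgv := v.2.1
  have hvg := v.2.2
  set p := x * g i * v.1 * g i * b * e with hp
  have hee : e * e = e := he.1
  have hep : e * p = p := by simp only [hp, ← mul_assoc, hex]
  have hpe : p * e = p := by simp only [hp, mul_assoc, hee]
  have hpp : p * p = p := by
    have : p * p = x * g i * v.1 * ((g i * b * e * x * g i) * v.1) * g i * b * e := by
      simp only [hp, mul_assoc]
    rw [this, hwv, mul_assoc _ (v.1), hvg]
  have hp0 : p ≠ 0 := by
    intro h0
    have h7 : (g i * b * e) * p * (x * g i) = g i * b * e * x * g i := by
      have : (g i * b * e) * p * (x * g i) = 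
        ((g i * b * e * x * g i) * v.1) * (g i * b * e * x * g i) := by
        simp only [hp, mul_assoc]
      rw [this, hwv]; simp only [← mul_assoc, hgg]
    rw [h0, mul_zero, zero_mul] at h7
    rw [← h7, zero_mul] at hwv
    apply hi; rw [← hwv]; simp
  have := he.2.2 p (e - p) hpp (by
    show (e - p) * (e - p) = e - p
    simp [mul_sub, sub_mul, hep, hpe, hpp, hee]) (by simp [mul_sub, hpe, hpp])
    (by simp [sub_mul, hep, hpp]) (by abel)
  rcases this with h | h
  · exact absurd h hp0
  · refine ⟨g i * v.1 * g i * b * e, ?_⟩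
    refine Eq.trans ?_ (sub_eq_zero.1 h).symm
    rw [hp]; simp only [mul_assoc]

lemma not_mem_rad {A : Type} [Ring A] {e : A} (hee : e * e = e) (h0 : e ≠ 0) :
    e ∉ ringRadical A := by
  intro h
  obtain ⟨z, hz⟩ := TwoSidedIdeal.mem_jacobson_iff.1 h (-1)
  replace hz : z * (-1) * e + z - 1 = 0 := hz
  apply h0
  have : (z * (-1) * e + z - 1) * e = -e := by
    simp [add_mul, sub_mul, mul_assoc, hee]
  rw [hz, zero_mul] at this
  simpa using this.symm

/-! Corner functor -/

/-- `X f` for a right module `X`. -/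
def Cor {A : Type} [Ring A] (f : A) (hf : IsIdempotentElem f) (X : Type) [AddCommGroup X]
    [Module Aᵐᵒᵖ X] : AddSubgroup X where
  carrier := {x | op f • x = x}
  add_mem' {a b} ha hb := by
    simp only [Set.mem_ofPred_eq] at *; rw [smul_add, ha, hb]
  zero_mem' := by simp
  neg_mem' {a} ha := by simp only [Set.mem_ofPred_eq] at *; rw [smul_neg, ha]

variable {A : Type} [Ring A] {f : A} {hf : IsIdempotentElem f} 
  {X Y Z : Type} [AddCommGroup X] [Module Aᵐᵒᵖ X] [AddCommGroup Y] [Module Aᵐᵒᵖ Y]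
  [AddCommGroup Z] [Module Aᵐᵒᵖ Z]

lemma mem_Cor {x : X} : x ∈ Cor f hf X ↔ op f • x = x := Iff.rfl

instance : Module (CornerRing f hf)ᵐᵒᵖ (Cor f hf X) where
  smul γ x := ⟨op γ.unop.1 • x.1, by
    rw [mem_Cor, smul_smul, ← op_mul, γ.unop.2.2]⟩
  one_smul x := Subtype.ext x.2
  mul_smul a b x := Subtype.ext (by
    show op (b.unop.1 * a.unop.1) • x.1 = op a.unop.1 • op b.unop.1 • x.1
    rw [smul_smul, op_mul])
  smul_zero a := Subtype.ext (smul_zero _)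
  smul_add a x y := Subtype.ext (smul_add _ _ _)
  add_smul a b x := Subtype.ext (by
    exact (congrArg (· • x.1) (op_add a.unop.1 b.unop.1)).trans (add_smul _ _ _))
  zero_smul x := Subtype.ext (by
    show op (0 : A) • x.1 = _
    rw [op_zero, zero_smul]; rfl)

lemma Cor.coe_smul (γ : (CornerRing f hf)ᵐᵒᵖ) (x : Cor f hf X) :
    ((γ • x : Cor f hf X) : X) = op γ.unop.1 • (x : X) := rfl

variable (hf) in
/-- Functoriality. -/
def corMap (φ : X →ₗ[Aᵐᵒᵖ] Y) : Cor f hf X →ₗ[(CornerRing f hf)ᵐᵒᵖ] Cor f hf Y where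
  toFun x := ⟨φ x.1, by rw [mem_Cor, ← map_smul, x.2]⟩
  map_add' x y := Subtype.ext (map_add φ _ _)
  map_smul' a x := Subtype.ext (map_smul φ _ _)

lemma corMap_coe (φ : X →ₗ[Aᵐᵒᵖ] Y) (x : Cor f hf X) : (corMap hf φ x : Y) = φ x := rfl

lemma corMap_inj {φ : X →ₗ[Aᵐᵒᵖ] Y} (h : Function.Injective φ) :
    Function.Injective (corMap hf φ) := fun x y hxy =>
  Subtype.ext (h (congrArg Subtype.val hxy))

lemma corMap_surj {φ : X →ₗ[Aᵐᵒᵖ] Y} (h : Function.Surjective φ) :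
    Function.Surjective (corMap hf φ) := by
  intro y
  obtain ⟨x, hx⟩ := h y.1
  refine ⟨⟨op f • x, ?_⟩, Subtype.ext ?_⟩
  · rw [mem_Cor, smul_smul, ← op_mul, hf]
  · rw [corMap_coe, map_smul, hx, y.2]

lemma corMap_exact {φ : X →ₗ[Aᵐᵒᵖ] Y} {ψ : Y →ₗ[Aᵐᵒᵖ] Z} (hφ : Function.Injective φ)
    (h : Function.Exact φ ψ) : Function.Exact (corMap hf φ) (corMap hf ψ) := by
  intro y
  constructor
  · intro hy
    obtain ⟨x, hx⟩ := (h y.1).1 (congrArg Subtype.val hy)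
    exact ⟨⟨x, hφ (by rw [map_smul, hx, y.2])⟩, Subtype.ext hx⟩
  · rintro ⟨x, rfl⟩
    exact Subtype.ext (h.apply_apply_eq_zero x.1)

/-! projective dimension for bare modules -/

section PD

variable (R : Type) [Ring R]

/-- projective dimension `< n`. -/
def PD (X : Type) [AddCommGroup X] [Module R X] (n : ℕ) : Prop :=
  HasProjectiveDimensionLT (ModuleCat.of R X) n

variable {R} {X Y Z : Type} [AddCommGroup X] [Module R X] [AddCommGroup Y] [Module R Y]
  [AddCommGroup Z] [Module R Z]

lemma PD.mono {n m : ℕ} (h : PD R X n) (hnm : n ≤ m) : PD R X m :=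
  haveI : HasProjectiveDimensionLT (ModuleCat.of R X) n := h
  hasProjectiveDimensionLT_of_ge _ n m hnm

lemma pd_one_iff : PD R X 1 ↔ Module.Projective R X := by
  rw [PD, ← projective_iff_hasProjectiveDimensionLT_one]
  exact (IsProjective.iff_projective X).symm

lemma ses {i : X →ₗ[R] Y} {p : Y →ₗ[R] Z} (hi : Function.Injective i)
    (hp : Function.Surjective p) (h : Function.Exact i p) :
    (ShortComplex.mk (ModuleCat.ofHom i) (ModuleCat.ofHom p) (by
      ext x; exact h.apply_apply_eq_zero x)).ShortExact where
  exact := by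
    rw [ShortComplex.ShortExact.moduleCat_exact_iff_function_exact]
    exact h
  mono_f := (ModuleCat.mono_iff_injective _).2 hi
  epi_g := (ModuleCat.epi_iff_surjective _).2 hp

lemma PD.two {i : X →ₗ[R] Y} {p : Y →ₗ[R] Z} (hi : Function.Injective i)
    (hp : Function.Surjective p) (h : Function.Exact i p) {n : ℕ} (h1 : PD R X n)
    (h3 : PD R Z n) : PD R Y n := (ses hi hp h).hasProjectiveDimensionLT_X₂ n h1 h3

lemma PD.three {i : X →ₗ[R] Y} {p : Y →ₗ[R] Z} (hi : Function.Injective i)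
    (hp : Function.Surjective p) (h : Function.Exact i p) {n : ℕ} (h1 : PD R X n)
    (h2 : PD R Y (n + 1)) : PD R Z (n + 1) := (ses hi hp h).hasProjectiveDimensionLT_X₃ n h1 h2

lemma PD.one {i : X →ₗ[R] Y} {p : Y →ₗ[R] Z} (hi : Function.Injective i)
    (hp : Function.Surjective p) (h : Function.Exact i p) {n : ℕ} (h2 : PD R Y n)
    (h3 : PD R Z (n + 1)) : PD R X n := (ses hi hp h).hasProjectiveDimensionLT_X₁ n h2 h3

lemma PD.retract {i : X →ₗ[R] Y} {r : Y →ₗ[R] X} (h : ∀ x, r (i x) = x) {n : ℕ}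
    (hY : PD R Y n) : PD R X n :=
  haveI : HasProjectiveDimensionLT (ModuleCat.of R Y) n := hY
  Retract.hasProjectiveDimensionLT (X := ModuleCat.of R X) (Y := ModuleCat.of R Y)
    ⟨ModuleCat.ofHom i, ModuleCat.ofHom r, by ext x; exact h x⟩ n

lemma PD.of_subsingleton [Subsingleton X] (n : ℕ) : PD R X n := by
  apply PD.mono (n := 0) _ (Nat.zero_le _)
  apply Limits.IsZero.hasProjectiveDimensionLT_zero
  exact ModuleCat.isZero_of_subsingleton _

lemma ker_exact_s3 (p : Y →ₗ[R] Z) : Function.Exact (LinearMap.ker p).subtype p := by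
  intro y; simp

lemma PD.finsupp (ι : Type) {n : ℕ} (h : PD R X (n + 1)) : PD R (ι →₀ X) (n + 1) := by
  induction n generalizing X with
  | zero =>
    rw [pd_one_iff] at h ⊢
    classical
    exact Module.Projective.of_equiv (finsuppLEquivDirectSum R X ι).symm
  | succ n ih =>
    let p := Finsupp.linearCombination R (id : X → X)
    have hp : Function.Surjective p := Finsupp.linearCombination_id_surjective R X
    have hK : PD R (LinearMap.ker p) (n + 1) :=
      PD.one (Submodule.subtype_injective _) hp (ker_exact_s3 p)
        ((pd_one_iff.2 inferInstance).mono (by omega)) h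
    refine PD.three (Y := ι →₀ (X →₀ R)) (i := Finsupp.mapRange.linearMap (α := ι) (LinearMap.ker p).subtype)
      (p := Finsupp.mapRange.linearMap (α := ι) p) ?_ ?_ ?_ (ih hK)
      ((pd_one_iff.2 inferInstance).mono (by omega))
    · exact Finsupp.mapRange_injective _ (map_zero _) (Submodule.subtype_injective _)
    · exact Finsupp.mapRange_surjective _ (map_zero _) hp
    · rw [LinearMap.exact_iff, Finsupp.ker_mapRange, Finsupp.range_mapRange_linearMap]
      · simp
      · simp

end PD

variable (hf) in
/-- The projection `X → X f`. -/
def corProj (X : Type) [AddCommGroup X] [Module Aᵐᵒᵖ X] : X →+ Cor f hf X where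
  toFun x := ⟨op f • x, by rw [mem_Cor, smul_smul, ← op_mul, hf]⟩
  map_zero' := Subtype.ext (smul_zero _)
  map_add' x y := Subtype.ext (smul_add _ _ _)

lemma corProj_coe (x : X) : (corProj hf X x : X) = op f • x := rfl

lemma corProj_smul (γ : (CornerRing f hf)ᵐᵒᵖ) (x : X) :
    corProj hf X (op γ.unop.1 • x) = γ • corProj hf X x := by
  apply Subtype.ext
  rw [Cor.coe_smul, corProj_coe, corProj_coe, smul_smul, smul_smul, ← op_mul, ← op_mul,
    γ.unop.2.1, γ.unop.2.2]

variable (hf X) in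
/-- sum of corners is the corner of a sum -/
noncomputable def corFinsuppI (ι : Type) : Cor f hf (ι →₀ X) →ₗ[(CornerRing f hf)ᵐᵒᵖ] (ι →₀ Cor f hf X) where
  toFun v := v.1.mapRange (corProj hf X) (map_zero _)
  map_add' v w := by
    ext j
    simp
  map_smul' γ v := by
    refine Finsupp.ext fun j => ?_
    simp only [Finsupp.mapRange_apply, Cor.coe_smul, Finsupp.smul_apply, RingHom.id_apply]
    exact corProj_smul γ _

variable (hf X) in
/-- sum of corners is the corner of a sum -/
noncomputable def corFinsuppR (ι : Type) : (ι →₀ Cor f hf X) →ₗ[(CornerRing f hf)ᵐᵒᵖ] Cor f hf (ι →₀ X) where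
  toFun w := ⟨w.mapRange (fun x : Cor f hf X => (x : X)) rfl, by
    rw [mem_Cor]
    refine Finsupp.ext fun j => ?_
    exact (w j).2⟩
  map_add' v w := Subtype.ext (Finsupp.ext fun j => rfl)
  map_smul' γ v := Subtype.ext (Finsupp.ext fun j => rfl)

lemma PD.corFinsupp (ι : Type) {n : ℕ} (h : PD (CornerRing f hf)ᵐᵒᵖ (Cor f hf X) (n + 1)) :
    PD (CornerRing f hf)ᵐᵒᵖ (Cor f hf (ι →₀ X)) (n + 1) := by
  refine PD.retract (i := corFinsuppI hf X ι) (r := corFinsuppR hf X ι) ?_ (PD.finsupp ι h)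
  intro v
  apply Subtype.ext
  refine Finsupp.ext fun j => ?_
  have := congrArg (fun w : ι →₀ X => w j) v.2
  exact this

/-- `A` as a right module versus `Aᵐᵒᵖ` as a left module. -/
def opL (A : Type) [Ring A] : A →ₗ[Aᵐᵒᵖ] Aᵐᵒᵖ where
  toFun := op
  map_add' _ _ := rfl
  map_smul' _ _ := rfl

/-- inverse. -/
def unopL (A : Type) [Ring A] : Aᵐᵒᵖ →ₗ[Aᵐᵒᵖ] A where
  toFun := unop
  map_add' _ _ := rfl
  map_smul' _ _ := rfl

theorem PD.cor {m n : ℕ} (hm : PD (CornerRing f hf)ᵐᵒᵖ (Cor f hf A) (m + 1))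
    (hX : PD Aᵐᵒᵖ X (n + 1)) : PD (CornerRing f hf)ᵐᵒᵖ (Cor f hf X) (n + m + 1) := by
  have hm' : PD (CornerRing f hf)ᵐᵒᵖ (Cor f hf Aᵐᵒᵖ) (m + 1) :=
    PD.retract (i := corMap hf (unopL A)) (r := corMap hf (opL A)) (fun x => rfl) hm
  induction n generalizing X with
  | zero =>
    rw [pd_one_iff] at hX
    obtain ⟨s, hs⟩ := hX.out
    rw [zero_add]
    exact PD.retract (i := corMap hf s)
      (r := corMap hf (Finsupp.linearCombination Aᵐᵒᵖ (id : X → X)))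
      (fun x => Subtype.ext (hs x.1)) (PD.corFinsupp X hm')
  | succ n ih =>
    let p := Finsupp.linearCombination Aᵐᵒᵖ (id : X → X)
    have hp : Function.Surjective p := Finsupp.linearCombination_id_surjective _ X
    have hK : PD Aᵐᵒᵖ (LinearMap.ker p) (n + 1) :=
      PD.one (Submodule.subtype_injective _) hp (ker_exact_s3 p)
        ((pd_one_iff.2 inferInstance).mono (by omega)) hX
    have := PD.three (corMap_inj (hf := hf) (Submodule.subtype_injective _))
      (corMap_surj (hf := hf) hp)
      (corMap_exact (Submodule.subtype_injective _) (ker_exact_s3 p)) (ih hK)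
      ((PD.corFinsupp X hm').mono (by omega))
    exact this.mono (by omega)

/-- left multiplication -/
def lm (a : A) : A →ₗ[Aᵐᵒᵖ] A where
  toFun x := a * x
  map_add' := mul_add a
  map_smul' r x := (mul_assoc a x r.unop).symm

lemma lm_apply (a x : A) : lm a x = a * x := rfl

variable (hf) in
/-- coinduced module -/
def CoInd (M : Type) [AddCommGroup M] [Module (CornerRing f hf)ᵐᵒᵖ M] : Type :=
  Cor f hf A →ₗ[(CornerRing f hf)ᵐᵒᵖ] M

section CoInd
variable {M : Type} [AddCommGroup M] [Module (CornerRing f hf)ᵐᵒᵖ M]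

instance : AddCommGroup (CoInd hf M) :=
  inferInstanceAs (AddCommGroup (Cor f hf A →ₗ[(CornerRing f hf)ᵐᵒᵖ] M))

/-- forget -/
def CoInd.fn (φ : CoInd hf M) : Cor f hf A →ₗ[(CornerRing f hf)ᵐᵒᵖ] M := φ

lemma CoInd.ext {φ ψ : CoInd hf M} (h : ∀ x, φ.fn x = ψ.fn x) : φ = ψ := LinearMap.ext h

instance : Module Aᵐᵒᵖ (CoInd hf M) where
  smul r φ := LinearMap.comp (CoInd.fn φ) (corMap hf (lm r.unop))
  one_smul φ := CoInd.ext fun x => congrArg φ.fn (Subtype.ext (one_mul x.1))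
  mul_smul r s φ := CoInd.ext fun x =>
    congrArg φ.fn (Subtype.ext (mul_assoc s.unop r.unop x.1))
  smul_zero r := rfl
  smul_add r φ ψ := rfl
  add_smul r s φ := CoInd.ext fun x =>
    (congrArg φ.fn (Subtype.ext (add_mul r.unop s.unop x.1))).trans (map_add φ.fn
      (corMap hf (lm r.unop) x) (corMap hf (lm s.unop) x))
  zero_smul φ := CoInd.ext fun x =>
    (congrArg φ.fn (Subtype.ext (zero_mul x.1))).trans (map_zero φ.fn)

lemma CoInd.smul_fn (r : Aᵐᵒᵖ) (φ : CoInd hf M) (x : Cor f hf A) :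
    (r • φ).fn x = φ.fn (corMap hf (lm r.unop) x) := rfl

variable (hf) in
/-- `f * x` as a corner element. -/
def cornerOf (x : Cor f hf A) : (CornerRing f hf)ᵐᵒᵖ :=
  op ⟨f * x.1, by rw [← mul_assoc, hf], by rw [mul_assoc]; exact congrArg (f * ·) x.2⟩

lemma cornerOf_val (x : Cor f hf A) : (cornerOf hf x).unop.1 = f * x.1 := rfl

lemma corner_ext {a b : (CornerRing f hf)ᵐᵒᵖ} (h : a.unop.1 = b.unop.1) : a = b :=
  unop_injective (Subtype.ext h)

variable (hf M) in
/-- unit -/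
def coUnit : M →ₗ[(CornerRing f hf)ᵐᵒᵖ] Cor f hf (CoInd hf M) where
  toFun m := ⟨({ toFun := fun x => cornerOf hf x • m
                 map_add' := fun x y => by
                  rw [← add_smul]; congr 1
                  exact corner_ext (mul_add f x.1 y.1)
                 map_smul' := fun γ x => by
                  rw [RingHom.id_apply, smul_smul]; congr 1
                  exact corner_ext (mul_assoc f x.1 γ.unop.1).symm } :
                  Cor f hf A →ₗ[(CornerRing f hf)ᵐᵒᵖ] M), by
        refine mem_Cor.2 (CoInd.ext fun x => ?_)
        show cornerOf hf _ • m = cornerOf hf _ • m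
        congr 1
        refine corner_ext ?_
        show f * (f * x.1) = f * x.1
        rw [← mul_assoc, hf]⟩
  map_add' m m' := Subtype.ext (CoInd.ext fun x => smul_add _ _ _)
  map_smul' γ m := by
    apply Subtype.ext
    refine CoInd.ext fun x => ?_
    rw [RingHom.id_apply, Cor.coe_smul, CoInd.smul_fn]
    show cornerOf hf x • γ • m = cornerOf hf _ • m
    rw [smul_smul]
    congr 1
    refine corner_ext ?_
    show γ.unop.1 * (f * x.1) = f * (γ.unop.1 * x.1)
    rw [← mul_assoc, ← mul_assoc, γ.unop.2.1, γ.unop.2.2]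

variable (hf) in
/-- `f` in `A f`. -/
def fCor : Cor f hf A := ⟨f, hf⟩

variable (hf M) in
/-- evaluation -/
def coEv : Cor f hf (CoInd hf M) →ₗ[(CornerRing f hf)ᵐᵒᵖ] M where
  toFun φ := φ.1.fn (fCor hf)
  map_add' φ ψ := rfl
  map_smul' γ φ := by
    rw [RingHom.id_apply, Cor.coe_smul, CoInd.smul_fn, ← map_smul]
    have h : φ.1.fn (corMap hf (lm f) (γ • fCor hf)) = φ.1.fn (γ • fCor hf) := by
      conv_rhs => rw [← φ.2, CoInd.smul_fn]
      rfl
    rw [← h]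
    congr 1
    apply Subtype.ext
    show γ.unop.1 * f = f * (f * γ.unop.1)
    rw [γ.unop.2.1, γ.unop.2.1, γ.unop.2.2]

lemma coEv_unit (m : M) : coEv hf M (coUnit hf M m) = m := by
  show cornerOf hf (fCor hf) • m = m
  have : cornerOf hf (fCor hf) = 1 := corner_ext hf
  rw [this, one_smul]

end CoInd

theorem fgd_of_cor {m : ℕ} (hm : PD (CornerRing f hf)ᵐᵒᵖ (Cor f hf A) (m + 1))
    (hA : HasFiniteGlobalDimension A) : HasFiniteGlobalDimension (CornerRing f hf) := by
  obtain ⟨n, hn⟩ := hA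
  refine ⟨n + m, fun M N i hi => ?_⟩
  have h1 : PD Aᵐᵒᵖ (CoInd hf M) (n + 1) :=
    HasProjectiveDimensionLT.mk fun i hi Y x => (hn _ _ i (by omega)).elim _ _
  have h2 := PD.retract (i := coUnit hf M) (r := coEv hf M) coEv_unit (PD.cor hm h1)
  have : HasProjectiveDimensionLT M (n + m + 1) := h2
  exact HasProjectiveDimensionLT.subsingleton M (n + m + 1) i (by omega) N


lemma mem_rightIdeal {e : A} (he : IsIdempotentElem e) {x : A} :
    x ∈ rightIdeal A e ↔ e * x = x := by
  rw [rightIdeal, Submodule.mem_span_singleton]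
  constructor
  · rintro ⟨r, rfl⟩
    show e * (e * r.unop) = e * r.unop
    rw [← mul_assoc, he]
  · intro h
    exact ⟨op x, h⟩

lemma rad_mul {j : A} (hj : j ∈ ringRadical A) (a : A) : j * a ∈ ringRadical A :=
  TwoSidedIdeal.mul_mem_right _ _ _ hj

lemma mul_rad {j : A} (hj : j ∈ ringRadical A) (a : A) : a * j ∈ ringRadical A :=
  TwoSidedIdeal.mul_mem_left _ _ _ hj

lemma mem_eRad {e : A} (he : IsIdempotentElem e) {x : A} :
    x ∈ eRad A e ↔ e * x = x ∧ x ∈ ringRadical A := by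
  constructor
  · intro h
    refine Submodule.span_induction (p := fun x _ => e * x = x ∧ x ∈ ringRadical A)
      ?_ ?_ ?_ ?_ h
    · rintro _ ⟨j, hj, rfl⟩
      refine ⟨?_, mul_rad hj e⟩
      show e * (e * j) = e * j
      rw [← mul_assoc, he]
    · exact ⟨mul_zero e, TwoSidedIdeal.zero_mem _⟩
    · rintro x y - - ⟨h1, h2⟩ ⟨h3, h4⟩
      exact ⟨by rw [mul_add, h1, h3], TwoSidedIdeal.add_mem _ h2 h4⟩
    · rintro r x - ⟨h1, h2⟩
      refine ⟨?_, rad_mul h2 r.unop⟩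
      show e * (x * r.unop) = x * r.unop
      rw [← mul_assoc, h1]
  · rintro ⟨h1, h2⟩
    exact Submodule.subset_span ⟨x, h2, h1⟩

/-- left multiplication into `eA`. -/
def lmTo {e : A} (he : IsIdempotentElem e) (a : A) (h : e * a = a) :
    A →ₗ[Aᵐᵒᵖ] rightIdeal A e :=
  (lm a).codRestrict _ fun x => by
    rw [mem_rightIdeal he, lm_apply, ← mul_assoc, h]

lemma lmTo_coe {e : A} (he : IsIdempotentElem e) (a : A) (h : e * a = a) (x : A) :
    (lmTo he a h x : A) = a * x := rfl

lemma pd_rightIdeal {e : A} (he : IsIdempotentElem e) : PD Aᵐᵒᵖ (rightIdeal A e) 1 :=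
  PD.retract (i := opL A ∘ₗ (rightIdeal A e).subtype) (r := lmTo he e he ∘ₗ unopL A)
    (fun x => Subtype.ext ((mem_rightIdeal he).1 x.2)) (pd_one_iff.2 inferInstance)

variable (hf) in
lemma pd_cor_f : PD (CornerRing f hf)ᵐᵒᵖ (Cor f hf (rightIdeal A f)) 1 := by
  refine PD.retract
    (i := { toFun := fun x => op ⟨x.1.1, (mem_rightIdeal hf).1 x.1.2, congrArg Subtype.val x.2⟩
            map_add' := fun x y => rfl
            map_smul' := fun γ x => rfl })
    (r := LinearMap.toSpanSingleton (CornerRing f hf)ᵐᵒᵖ (Cor f hf (rightIdeal A f))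
      ⟨⟨f, (mem_rightIdeal hf).2 hf⟩, Subtype.ext hf⟩)
    ?_ (pd_one_iff.2 inferInstance)
  intro x
  apply Subtype.ext
  apply Subtype.ext
  exact (mem_rightIdeal hf).1 x.1.2

lemma one_sub_mul_eq_zero {e x : A} : (1 - e) * x = 0 ↔ e * x = x := by
  rw [sub_mul, one_mul, sub_eq_zero, eq_comm]

lemma pd_cor_A {e : A} (he : IsIdempotentElem e) {n : ℕ}
    (h : PD (CornerRing (1 - e) he.one_sub)ᵐᵒᵖ (Cor (1 - e) he.one_sub (rightIdeal A e)) (n + 1)) :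
    PD (CornerRing (1 - e) he.one_sub)ᵐᵒᵖ (Cor (1 - e) he.one_sub A) (n + 1) := by
  refine PD.two (corMap_inj (Submodule.subtype_injective (rightIdeal A e)))
    (corMap_surj (φ := lmTo he.one_sub (1 - e) he.one_sub) ?_)
    (corMap_exact (Submodule.subtype_injective (rightIdeal A e)) ?_) h
      ((pd_cor_f he.one_sub).mono (by omega))
  · intro y
    exact ⟨y.1, Subtype.ext ((mem_rightIdeal he.one_sub).1 y.2)⟩
  · intro y
    have h1 : lmTo he.one_sub (1 - e) he.one_sub y = 0 ↔ (1 - e) * y = 0 :=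
      ⟨fun h => congrArg Subtype.val h, fun h => Subtype.ext h⟩
    refine h1.trans (one_sub_mul_eq_zero.trans ((mem_rightIdeal he).symm.trans ?_))
    exact ⟨fun h => ⟨⟨y, h⟩, rfl⟩, fun ⟨z, hz⟩ => hz ▸ z.2⟩

/-- case a -/
lemma pd_case_a {e : A} (he : IsIdempotentElem e) {x a : A} (hex : e * x = x)
    (hxf : x * (1 - e) = x) (hxa : x * a = e) :
    PD (CornerRing (1 - e) he.one_sub)ᵐᵒᵖ (Cor (1 - e) he.one_sub (rightIdeal A e)) 1 := by
  refine PD.retract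
    (i := corMap he.one_sub (lmTo he.one_sub ((1 - e) * a) (by rw [← mul_assoc, he.one_sub]) ∘ₗ
      (rightIdeal A e).subtype))
    (r := corMap he.one_sub (lmTo he x hex ∘ₗ (rightIdeal A (1 - e)).subtype)) ?_
    (pd_cor_f he.one_sub)
  intro y
  apply Subtype.ext
  apply Subtype.ext
  show x * ((1 - e) * a * y.1.1) = y.1.1
  rw [mul_assoc, ← mul_assoc, hxf, ← mul_assoc, hxa]
  exact (mem_rightIdeal he).1 y.1.2

/-- quotient map -/
def seMk (e : A) : rightIdeal A e →ₗ[Aᵐᵒᵖ] SeModule A e :=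
  Submodule.mkQ ((eRad A e).comap (rightIdeal A e).subtype)

lemma seMk_surj (e : A) : Function.Surjective (seMk e) := Submodule.mkQ_surjective _

lemma seMk_eq_zero {e : A} {x : rightIdeal A e} : seMk e x = 0 ↔ (x : A) ∈ eRad A e := by
  exact Submodule.Quotient.mk_eq_zero ((eRad A e).comap (rightIdeal A e).subtype)

lemma span_eq_top (hsemi : IsSemiperfectRing A) {e : A} (he : IsPrimitiveIdempotent e)
    [Module.Finite Aᵐᵒᵖ X] (h0 : ∀ φ : X →ₗ[Aᵐᵒᵖ] SeModule A e, φ = 0) :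
    Submodule.span Aᵐᵒᵖ {x : X | op (1 - e) • x = x} = ⊤ := by
  by_contra hne
  obtain ⟨M, hM, hle⟩ := (eq_top_or_exists_le_coatom _).resolve_left hne
  obtain ⟨x, -, hx⟩ := SetLike.exists_of_lt hM.lt_top
  let t : X ⧸ M := M.mkQ x
  have ht0 : t ≠ 0 := by
    intro h
    apply hx
    rwa [← Submodule.ker_mkQ M, LinearMap.mem_ker]
  have hte : op e • t = t := by
    have h1 : op (1 - e) • x ∈ M := by
      apply hle
      apply Submodule.subset_span
      show op (1 - e) • op (1 - e) • x = op (1 - e) • x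
      rw [smul_smul, ← op_mul, he.1.one_sub]
    have h2 : op (1 - e) • t = 0 := by
      rw [← map_smul, ← LinearMap.mem_ker, Submodule.ker_mkQ]; exact h1
    rw [MulOpposite.op_sub, sub_smul, MulOpposite.op_one, one_smul, sub_eq_zero] at h2
    exact h2.symm
  have : IsSimpleModule Aᵐᵒᵖ (X ⧸ M) := isSimpleModule_iff_isCoatom.2 hM
  let q : rightIdeal A e →ₗ[Aᵐᵒᵖ] X ⧸ M :=
    LinearMap.toSpanSingleton Aᵐᵒᵖ _ t ∘ₗ opL A ∘ₗ (rightIdeal A e).subtype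
  have hq : ∀ y, q y = op y.1 • t := fun y => rfl
  have hee : e * e = e := he.1
  let e' : rightIdeal A e := ⟨e, (mem_rightIdeal he.1).2 hee⟩
  have hqe : q e' = t := hte
  have hqs : Function.Surjective q := by
    apply LinearMap.surjective_of_ne_zero
    intro h
    rw [h] at hqe
    exact ht0 hqe.symm
  have hker : LinearMap.ker q ≤ LinearMap.ker (seMk e) := by
    intro y hy
    rw [LinearMap.mem_ker, seMk_eq_zero, mem_eRad he.1]
    refine ⟨(mem_rightIdeal he.1).1 y.2, ?_⟩
    by_contra hr
    obtain ⟨a, ha⟩ := lemL hsemi he ((mem_rightIdeal he.1).1 y.2) hr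
    have hya : op a • y = e' := Subtype.ext ha
    apply ht0
    rw [← hqe, ← hya, map_smul, LinearMap.mem_ker.1 hy, smul_zero]
  let ψ : (X ⧸ M) →ₗ[Aᵐᵒᵖ] SeModule A e :=
    (LinearMap.ker q).liftQ (seMk e) hker ∘ₗ (q.quotKerEquivOfSurjective hqs).symm.toLinearMap
  have hψ : ψ t = seMk e e' := by
    show (LinearMap.ker q).liftQ (seMk e) hker ((q.quotKerEquivOfSurjective hqs).symm t) = _
    have : (q.quotKerEquivOfSurjective hqs).symm t = (LinearMap.ker q).mkQ e' := by
      rw [LinearEquiv.symm_apply_eq]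
      exact hqe.symm
    rw [this]
    simp
  have h3 := h0 (ψ ∘ₗ M.mkQ)
  have h4 : ψ t = 0 := congrArg (fun φ : X →ₗ[Aᵐᵒᵖ] SeModule A e => φ x) h3
  rw [hψ, seMk_eq_zero, mem_eRad he.1] at h4
  exact not_mem_rad hee he.2.1 h4.2

lemma ext_zero_iff {R : Type} [Ring R] {X Y : Type} [AddCommGroup X] [Module R X]
    [AddCommGroup Y] [Module R Y] :
    Subsingleton (Ext (ModuleCat.of R X) (ModuleCat.of R Y) 0) ↔ ∀ φ : X →ₗ[R] Y, φ = 0 := by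
  rw [Ext.homEquiv₀.subsingleton_congr, (ModuleCat.homEquiv).subsingleton_congr]
  constructor
  · intro h φ
    exact Subsingleton.elim _ _
  · intro h
    exact ⟨fun a b => (h a).trans (h b).symm⟩

lemma ext_sub {R : Type} [Ring R] {X Y Z : Type} [AddCommGroup X] [Module R X]
    [AddCommGroup Y] [Module R Y] [AddCommGroup Z] [Module R Z]
    {i : X →ₗ[R] Y} {p : Y →ₗ[R] Z} (hi : Function.Injective i)
    (hp : Function.Surjective p) (h : Function.Exact i p) (N : ModuleCat.{0} R) (k : ℕ)
    (hZ : Subsingleton (Ext (ModuleCat.of R Z) N (k + 1)))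
    (hY : ∀ x : Ext (ModuleCat.of R Y) N k,
      (Ext.mk₀ (ModuleCat.ofHom i)).comp x (zero_add k) = 0) :
    Subsingleton (Ext (ModuleCat.of R X) N k) := by
  refine subsingleton_of_forall_eq 0 fun x₁ => ?_
  obtain ⟨x₂, rfl⟩ := Ext.contravariant_sequence_exact₁ (ses hi hp h) N x₁ (add_comm 1 k)
    (hZ.elim _ _)
  exact hY x₂

lemma ext_sub' {R : Type} [Ring R] {X Y Z M : Type} [AddCommGroup X] [Module R X]
    [AddCommGroup Y] [Module R Y] [AddCommGroup Z] [Module R Z] [AddCommGroup M] [Module R M]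
    {i : X →ₗ[R] Y} {p : Y →ₗ[R] Z} (hi : Function.Injective i)
    (hp : Function.Surjective p) (h : Function.Exact i p) (hY : PD R Y 1)
    (h0 : ∀ (φ : Y →ₗ[R] M) (x : X), φ (i x) = 0)
    (hZ : ∀ k, Subsingleton (Ext (ModuleCat.of R Z) (ModuleCat.of R M) (k + 1))) (k : ℕ) :
    Subsingleton (Ext (ModuleCat.of R X) (ModuleCat.of R M) k) := by
  refine ext_sub hi hp h _ k (hZ k) fun x₂ => ?_
  obtain _ | k := k
  · obtain ⟨φ, rfl⟩ := Ext.homEquiv₀.symm.surjective x₂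
    rw [Ext.homEquiv₀_symm_apply, Ext.mk₀_comp_mk₀]
    have hz : ModuleCat.ofHom i ≫ φ = 0 := by
      ext x
      exact h0 φ.hom x
    rw [hz, Ext.mk₀_zero]
  · have : HasProjectiveDimensionLT (ModuleCat.of R Y) 1 := hY
    have := HasProjectiveDimensionLT.subsingleton (ModuleCat.of R Y) 1
      (k + 1) (by omega) (ModuleCat.of R M)
    rw [this.elim x₂ 0, Ext.comp_zero]

lemma exists_cover_s3 (hsemi : IsSemiperfectRing A) {e : A}
    (he : IsPrimitiveIdempotent e) (hS : ∀ s : SeModule A e, op (1 - e) • s = 0)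
    (X : Type) [AddCommGroup X] [Module Aᵐᵒᵖ X] [Module.Finite Aᵐᵒᵖ X]
    (h0 : ∀ φ : X →ₗ[Aᵐᵒᵖ] SeModule A e, φ = 0) :
    ∃ (Q : Type) (_ : AddCommGroup Q) (_ : Module Aᵐᵒᵖ Q) (π : Q →ₗ[Aᵐᵒᵖ] X),
      Function.Surjective π ∧ Module.Finite Aᵐᵒᵖ Q ∧ PD Aᵐᵒᵖ Q 1 ∧
      PD (CornerRing (1 - e) he.1.one_sub)ᵐᵒᵖ (Cor (1 - e) he.1.one_sub Q) 1 ∧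
      ∀ φ : Q →ₗ[Aᵐᵒᵖ] SeModule A e, φ = 0 := by
  have htop := span_eq_top hsemi he h0
  have hfg : (Submodule.span Aᵐᵒᵖ {x : X | op (1 - e) • x = x}).FG := by
    rw [htop]; exact Module.Finite.fg_top
  obtain ⟨t, ht, hspan⟩ := (Submodule.fg_span_iff_fg_span_finset_subset _).1 hfg
  rw [htop] at hspan
  have hf := he.1.one_sub
  have hfin : Module.Finite Aᵐᵒᵖ (rightIdeal A (1 - e)) :=
    Module.Finite.iff_fg.2 (Submodule.fg_span_singleton _)
  refine ⟨t →₀ rightIdeal A (1 - e), inferInstance, inferInstance,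
    Finsupp.lsum ℕ fun y : t =>
      LinearMap.toSpanSingleton Aᵐᵒᵖ _ (y : X) ∘ₗ opL A ∘ₗ (rightIdeal A (1 - e)).subtype,
    ?_, inferInstance, PD.finsupp t (pd_rightIdeal hf), PD.corFinsupp t (pd_cor_f hf), ?_⟩
  · rw [← LinearMap.range_eq_top, ← top_le_iff, hspan, Submodule.span_le]
    intro y hy
    refine ⟨Finsupp.single ⟨y, hy⟩ ⟨1 - e, (mem_rightIdeal hf).2 hf⟩, ?_⟩
    rw [Finsupp.lsum_single]
    exact ht hy
  · intro φ
    refine Finsupp.lhom_ext fun y q => ?_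
    rw [LinearMap.zero_apply]
    have : Finsupp.single y q = op q.1 • op (1 - e) •
        (Finsupp.single y ⟨1 - e, (mem_rightIdeal hf).2 hf⟩ :
          t →₀ rightIdeal A (1 - e)) := by
      rw [Finsupp.smul_single, Finsupp.smul_single]
      congr 1
      apply Subtype.ext
      show q.1 = (1 - e) * (1 - e) * q.1
      rw [hf, (mem_rightIdeal hf).1 q.2]
    rw [this, map_smul, map_smul, hS, smul_zero]

theorem pd_induct (hN : IsNoetherianRing Aᵐᵒᵖ) (hsemi : IsSemiperfectRing A) {e : A}
    (he : IsPrimitiveIdempotent e) (hS : ∀ s : SeModule A e, op (1 - e) • s = 0) (n : ℕ)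
    (X : Type) [AddCommGroup X] [Module Aᵐᵒᵖ X] [Module.Finite Aᵐᵒᵖ X]
    (hX : PD Aᵐᵒᵖ X (n + 1))
    (hE : ∀ i, Subsingleton (Ext (ModuleCat.of Aᵐᵒᵖ X) (ModuleCat.of Aᵐᵒᵖ (SeModule A e)) i)) :
    PD (CornerRing (1 - e) he.1.one_sub)ᵐᵒᵖ (Cor (1 - e) he.1.one_sub X) (n + 1) := by
  induction n generalizing X with
  | zero =>
    obtain ⟨Q, _, _, π, hπ, hfin, hQA, hQ, h0⟩ :=
      exists_cover_s3 hsemi he hS X (ext_zero_iff.1 (hE 0))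
    rw [pd_one_iff] at hX
    obtain ⟨s, hs⟩ := Module.projective_lifting_property π LinearMap.id hπ
    have hs' : ∀ x, π (s x) = x := fun x => LinearMap.congr_fun hs x
    refine PD.retract (i := corMap he.1.one_sub s) (r := corMap he.1.one_sub π) ?_ hQ
    intro x
    exact Subtype.ext (hs' x.1)
  | succ n ih =>
    obtain ⟨Q, _, _, π, hπ, hfin, hQA, hQ, h0⟩ :=
      exists_cover_s3 hsemi he hS X (ext_zero_iff.1 (hE 0))
    have hNQ : IsNoetherian Aᵐᵒᵖ Q := isNoetherian_of_isNoetherianRing_of_finite Aᵐᵒᵖ Q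
    refine PD.three (corMap_inj (Submodule.subtype_injective (LinearMap.ker π)))
      (corMap_surj hπ)
      (corMap_exact (Submodule.subtype_injective _) (ker_exact_s3 π))
      (ih (LinearMap.ker π) ?_ ?_) (hQ.mono (by omega))
    · exact PD.one (Submodule.subtype_injective _) hπ (ker_exact_s3 π) (hQA.mono (by omega)) hX
    · refine ext_sub' (Submodule.subtype_injective (LinearMap.ker π)) hπ (ker_exact_s3 π) hQA
        (fun φ x => ?_) fun k => hE (k + 1)
      rw [h0 φ, LinearMap.zero_apply]

lemma seMk_vanish {e : A} (he : IsIdempotentElem e) (φ : rightIdeal A e →ₗ[Aᵐᵒᵖ] SeModule A e)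
    (x : LinearMap.ker (seMk e)) : φ x.1 = 0 := by
  obtain ⟨y, hy⟩ := seMk_surj e (φ ⟨e, (mem_rightIdeal he).2 he⟩)
  have hx : ((x.1 : rightIdeal A e) : A) ∈ eRad A e := seMk_eq_zero.1 x.2
  have h1 : x.1 = op x.1.1 • (⟨e, (mem_rightIdeal he).2 he⟩ : rightIdeal A e) :=
    Subtype.ext ((mem_rightIdeal he).1 x.1.2).symm
  have h2 : φ x.1 = op x.1.1 • φ ⟨e, (mem_rightIdeal he).2 he⟩ :=
    (congrArg φ h1).trans (map_smul φ _ _)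
  rw [h2, ← hy, ← map_smul]
  refine seMk_eq_zero.2 ((mem_eRad he).2 ⟨?_, mul_rad ((mem_eRad he).1 hx).2 y.1⟩)
  exact (mem_rightIdeal he).1 (op x.1.1 • y).2

theorem pd_case_b (hN : IsNoetherianRing Aᵐᵒᵖ) (hsemi : IsSemiperfectRing A) {e : A}
    (he : IsPrimitiveIdempotent e) (hS : ∀ s : SeModule A e, op (1 - e) • s = 0)
    (hA : HasFiniteGlobalDimension A)
    (hExt : ∀ i : ℕ, 0 < i → Subsingleton (Ext (Se A e) (Se A e) i)) :
    ∃ n, PD (CornerRing (1 - e) he.1.one_sub)ᵐᵒᵖ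
      (Cor (1 - e) he.1.one_sub (rightIdeal A e)) (n + 1) := by
  obtain ⟨n, hn⟩ := hA
  have hfin : Module.Finite Aᵐᵒᵖ (rightIdeal A e) :=
    Module.Finite.iff_fg.2 (Submodule.fg_span_singleton _)
  have hNQ : IsNoetherian Aᵐᵒᵖ (rightIdeal A e) :=
    isNoetherian_of_isNoetherianRing_of_finite _ _
  refine ⟨n, PD.two (corMap_inj (Submodule.subtype_injective (LinearMap.ker (seMk e))))
    (corMap_surj (seMk_surj e))
    (corMap_exact (Submodule.subtype_injective _) (ker_exact_s3 (seMk e)))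
    (pd_induct hN hsemi he hS n _ ?_ ?_) ?_⟩
  · exact HasProjectiveDimensionLT.mk fun i hi Y x => (hn _ _ i (by omega)).elim _ _
  · exact ext_sub' (Submodule.subtype_injective (LinearMap.ker (seMk e))) (seMk_surj e)
      (ker_exact_s3 (seMk e)) (pd_rightIdeal he.1) (fun φ x => seMk_vanish he.1 φ x)
      (fun k => hExt (k + 1) (by omega))
  · have : Subsingleton (Cor (1 - e) he.1.one_sub (SeModule A e)) :=
      ⟨fun a b => Subtype.ext (by rw [← a.2, ← b.2, hS, hS])⟩
    exact PD.of_subsingleton _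

theorem main_aux (hN : IsNoetherianRing Aᵐᵒᵖ) (hsemi : IsSemiperfectRing A) {e : A}
    (he : IsPrimitiveIdempotent e) (hA : HasFiniteGlobalDimension A)
    (hExt : ∀ i : ℕ, 0 < i → Subsingleton (Ext (Se A e) (Se A e) i)) :
    HasFiniteGlobalDimension (CornerRing (1 - e) he.1.one_sub) := by
  obtain ⟨n, hn⟩ : ∃ n, PD (CornerRing (1 - e) he.1.one_sub)ᵐᵒᵖ
      (Cor (1 - e) he.1.one_sub (rightIdeal A e)) (n + 1) := by
    by_cases h : ∃ x, e * x = x ∧ x * (1 - e) = x ∧ x ∉ ringRadical A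
    · obtain ⟨x, h1, h2, h3⟩ := h
      obtain ⟨a, ha⟩ := lemL hsemi he h1 h3
      exact ⟨0, pd_case_a he.1 h1 h2 ha⟩
    · push Not at h
      refine pd_case_b hN hsemi he (fun s => ?_) hA hExt
      obtain ⟨y, rfl⟩ := seMk_surj e s
      rw [← map_smul, seMk_eq_zero, mem_eRad he.1]
      have h1 := (mem_rightIdeal he.1).1 (op (1 - e) • y).2
      refine ⟨h1, h _ h1 ?_⟩
      show y.1 * (1 - e) * (1 - e) = y.1 * (1 - e)
      rw [mul_assoc, he.1.one_sub]
  exact fgd_of_cor (pd_cor_A he.1 hn) hA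

end Helpers


/-- **Remark (Proposition 4.4(3) of [IP]).** Let `A` be a Noetherian semiperfect basic ring.
If `A` has finite global dimension and `e` is a primitive idempotent with
`Ext^i_A(S_e, S_e) = 0` for all `i > 0`, then `Γ = (1-e)A(1-e)` has finite global
dimension. -/
theorem hasFiniteGlobalDimension_corner_of_primitive_of_ext_vanishing
    (A : Type) [Ring A] (hNoeth : IsTwoSidedNoetherian A)
    (hsemi : IsSemiperfectRing A) (hbasic : IsBasicRing A)
    (e : A) (he : IsPrimitiveIdempotent e)
    (hA : HasFiniteGlobalDimension A)
    (hExt : ∀ i : ℕ, 0 < i → Subsingleton (CategoryTheory.Abelian.Ext (Se A e) (Se A e) i)) :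
    HasFiniteGlobalDimension (CornerRing (1 - e) he.1.one_sub) := by
  exact main_aux hNoeth.2 hsemi he hA hExt
end
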